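/- arXiv:2306.13801 — 4 statements merged into one kernel-verified Lean document; each statement's English description precedes it below -/
import Mathlib

section
/- (Chain rule for KL divergence.) Let μ^{XY} and π^{XY} be probability measures on a product of standard Borel spaces X × Y with μ^{XY} absolutely continuous with respect to π^{XY}. Denote by μ^X, π^X the X-marginals and by μ^{Y|X=x}, π^{Y|X=x} the regular conditional distributions of the second coordinate given the first. Then D_KL(μ^{XY} ‖ π^{XY}) = D_KL(μ^X ‖ π^X) + E_{x ∼ μ^X}[ D_KL(μ^{Y|X=x} ‖ π^{Y|X=x}) ]. -/
open MeasureTheory ProbabilityTheory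
open scoped ENNReal Classical

noncomputable section

/-- Kullback–Leibler divergence `D_KL(μ ‖ ν) = ∫ log(dμ/dν) dμ` (valued in `[0,∞]`,
with the convention that it is `∞` when `μ` is not absolutely continuous w.r.t. `ν`;
for `μ ≪ ν` it is computed via the nonnegative integrand `f log f − f + 1`,
`f = dμ/dν`, integrated against `ν`). -/

def klDiv {X : Type*} [MeasurableSpace X] (μ ν : Measure X) : ℝ≥0∞ :=
  if μ ≪ ν then
    ∫⁻ x, ENNReal.ofReal ((μ.rnDeriv ν x).toReal * Real.log (μ.rnDeriv ν x).toReal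
      - (μ.rnDeriv ν x).toReal + 1) ∂ν
  else ⊤

lemma klDiv_of_absolutelyContinuous {X : Type*} [MeasurableSpace X] {μ ν : Measure X}
    (h : μ ≪ ν) :
    klDiv μ ν = ∫⁻ x, ENNReal.ofReal (InformationTheory.klFun (μ.rnDeriv ν x).toReal) ∂ν := by
  simp only [klDiv, h, if_true, InformationTheory.klFun_apply, add_sub_right_comm]

/-- `klDiv` agrees with Mathlib's Kullback–Leibler divergence on finite measures. -/
lemma klDiv_eq_informationTheory_klDiv {X : Type*} [MeasurableSpace X] (μ ν : Measure X)
    [IsFiniteMeasure μ] [IsFiniteMeasure ν] :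
    klDiv μ ν = InformationTheory.klDiv μ ν := by
  by_cases h : μ ≪ ν
  · rw [klDiv_of_absolutelyContinuous h, InformationTheory.klDiv_eq_lintegral_klFun_of_ac h]
  · rw [klDiv, if_neg h, InformationTheory.klDiv_of_not_ac h]

/-- The Radon–Nikodym derivative of composition-products over a common base measure is the
Radon–Nikodym derivative of the kernels. -/
lemma rnDeriv_compProd_right {X Y : Type*} [MeasurableSpace X] [MeasurableSpace Y]
    [MeasurableSpace.CountableOrCountablyGenerated X Y]
    {μ : Measure X} [IsFiniteMeasure μ] {κ η : Kernel X Y} [IsFiniteKernel κ] [IsFiniteKernel η]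
    (h : μ ⊗ₘ κ ≪ μ ⊗ₘ η) :
    (μ ⊗ₘ κ).rnDeriv (μ ⊗ₘ η) =ᵐ[μ ⊗ₘ η] fun p ↦ Kernel.rnDeriv κ η p.1 p.2 := by
  have hm : Measurable fun p : X × Y ↦ Kernel.rnDeriv κ η p.1 p.2 := by fun_prop
  have h_eq : (μ ⊗ₘ η).withDensity (fun p ↦ Kernel.rnDeriv κ η p.1 p.2) = μ ⊗ₘ κ := by
    ext s hs
    rw [withDensity_apply _ hs, ← lintegral_indicator hs,
      Measure.lintegral_compProd (hm.indicator hs), Measure.compProd_apply hs]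
    refine lintegral_congr_ae ?_
    filter_upwards [h.kernel_of_compProd] with x hx
    have hsx : MeasurableSet (Prod.mk x ⁻¹' s) := measurable_prodMk_left hs
    calc ∫⁻ y, s.indicator (fun p ↦ Kernel.rnDeriv κ η p.1 p.2) (x, y) ∂η x
      _ = ∫⁻ y in Prod.mk x ⁻¹' s, Kernel.rnDeriv κ η x y ∂η x := by
        rw [← lintegral_indicator hsx]; rfl
      _ = ∫⁻ y in Prod.mk x ⁻¹' s, (κ x).rnDeriv (η x) y ∂η x :=
        lintegral_congr_ae (ae_restrict_of_ae Kernel.rnDeriv_eq_rnDeriv_measure)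
      _ = κ x (Prod.mk x ⁻¹' s) := Measure.setLIntegral_rnDeriv hx _
  rw [← h_eq]
  exact Measure.rnDeriv_withDensity _ hm

/-- The divergence of composition-products over a common base measure is the integral of the
divergences of the kernels. -/
lemma klDiv_compProd_right {X Y : Type*} [MeasurableSpace X] [MeasurableSpace Y]
    [MeasurableSpace.CountableOrCountablyGenerated X Y]
    {μ : Measure X} [IsFiniteMeasure μ] {κ η : Kernel X Y} [IsFiniteKernel κ] [IsFiniteKernel η]
    (h : μ ⊗ₘ κ ≪ μ ⊗ₘ η) :
    klDiv (μ ⊗ₘ κ) (μ ⊗ₘ η) = ∫⁻ x, klDiv (κ x) (η x) ∂μ := by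
  calc klDiv (μ ⊗ₘ κ) (μ ⊗ₘ η)
    _ = ∫⁻ p, ENNReal.ofReal (InformationTheory.klFun (Kernel.rnDeriv κ η p.1 p.2).toReal)
        ∂(μ ⊗ₘ η) := by
      rw [klDiv_of_absolutelyContinuous h]
      refine lintegral_congr_ae ?_
      filter_upwards [rnDeriv_compProd_right h] with p hp
      rw [hp]
    _ = ∫⁻ x, ∫⁻ y, ENNReal.ofReal (InformationTheory.klFun (Kernel.rnDeriv κ η x y).toReal)
        ∂η x ∂μ := Measure.lintegral_compProd (by fun_prop)
    _ = ∫⁻ x, klDiv (κ x) (η x) ∂μ := by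
      refine lintegral_congr_ae ?_
      filter_upwards [h.kernel_of_compProd] with x hx
      rw [klDiv_of_absolutelyContinuous hx]
      refine lintegral_congr_ae ?_
      filter_upwards [Kernel.rnDeriv_eq_rnDeriv_measure (κ := κ) (η := η) (a := x)] with y hy
      rw [hy]

/-- chain rule for KL divergence: for probability measures `μ ≪ ν` on a
product of standard Borel spaces,
`D_KL(μ ‖ ν) = D_KL(μ^X ‖ ν^X) + E_{x ∼ μ^X}[D_KL(μ^{Y|X=x} ‖ ν^{Y|X=x})]`. -/
theorem kl_chain_rule {X Y : Type*}
    [MeasurableSpace X] [StandardBorelSpace X]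
    [MeasurableSpace Y] [StandardBorelSpace Y] [Nonempty Y]
    (μ ν : Measure (X × Y)) [IsProbabilityMeasure μ] [IsProbabilityMeasure ν]
    (hac : μ ≪ ν) :
    klDiv μ ν =
      klDiv μ.fst ν.fst + ∫⁻ x, klDiv (μ.condKernel x) (ν.condKernel x) ∂μ.fst := by
  have h_ac : μ.fst ⊗ₘ μ.condKernel ≪ ν.fst ⊗ₘ ν.condKernel := by
    rwa [μ.disintegrate, ν.disintegrate]
  have h_ac_right := Measure.absolutelyContinuous_compProd_of_compProd h_ac
  calc klDiv μ ν
    _ = InformationTheory.klDiv (μ.fst ⊗ₘ μ.condKernel) (ν.fst ⊗ₘ ν.condKernel) := by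
      rw [klDiv_eq_informationTheory_klDiv, μ.disintegrate, ν.disintegrate]
    _ = klDiv μ.fst ν.fst
        + klDiv (μ.fst ⊗ₘ μ.condKernel) (μ.fst ⊗ₘ ν.condKernel) := by
      rw [InformationTheory.klDiv_compProd_eq_add, klDiv_eq_informationTheory_klDiv,
        klDiv_eq_informationTheory_klDiv]
    _ = klDiv μ.fst ν.fst + ∫⁻ x, klDiv (μ.condKernel x) (ν.condKernel x) ∂μ.fst := by
      rw [klDiv_compProd_right h_ac_right]

end
end

section
/- Let d ≥ 1, η > 0, t ∈ (0,1), let f : ℝ^d → ℝ be α_f-strongly convex and g : ℝ^d → ℝ be α_g-strongly convex (α_f, α_g > 0), and assume exp(−f) and exp(−g) are integrable. Define φ_t(z) = ∫_{ℝ^d} exp(−g(y) − ‖z−y‖²/(2η(1−t))) dy and φ̂_t(z) = ∫_{ℝ^d} exp(−f(x) − ‖z−x‖²/(2ηt)) dx. Then the function z ↦ −log(φ_t(z) · φ̂_t(z)) is strongly convex on ℝ^d with constant α_f/(1 + η t α_f) + α_g/(1 + η(1−t) α_g). -/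
open MeasureTheory Real

noncomputable section

open scoped ENNReal Pointwise

theorem volume_add_le_volume_add_of_isCompact {A B : Set ℝ} (hA : IsCompact A) (hB : IsCompact B)
    (hA' : A.Nonempty) (hB' : B.Nonempty) :
    volume A + volume B ≤ volume (A + B) := by
  obtain ⟨M, hMA, hM⟩ := hA.exists_isGreatest hA'
  obtain ⟨m, hmB, hm⟩ := hB.exists_isLeast hB'
  have hsub : (m +ᵥ A) ∪ (M +ᵥ B) ⊆ A + B := by
    rintro x (⟨y, hy, rfl⟩ | ⟨y, hy, rfl⟩)
    · exact ⟨y, hy, m, hmB, add_comm _ _⟩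
    · exact ⟨M, hMA, y, hy, rfl⟩
  have hinter : (m +ᵥ A) ∩ (M +ᵥ B) ⊆ {M + m} := by
    rintro x ⟨⟨y, hy, rfl⟩, ⟨z, hz, hzy⟩⟩
    have h1 := hM hy
    have h2 := hm hz
    simp only [vadd_eq_add, Set.mem_singleton_iff] at hzy ⊢
    linarith
  have hmeas : MeasurableSet (M +ᵥ B) := (hB.vadd M).measurableSet
  calc volume A + volume B = volume (m +ᵥ A) + volume (M +ᵥ B) := by
        rw [measure_vadd, measure_vadd]
    _ = volume ((m +ᵥ A) ∪ (M +ᵥ B)) + volume ((m +ᵥ A) ∩ (M +ᵥ B)) :=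
        (measure_union_add_inter _ hmeas).symm
    _ = volume ((m +ᵥ A) ∪ (M +ᵥ B)) := by
        rw [measure_mono_null hinter (measure_singleton _), add_zero]
    _ ≤ volume (A + B) := measure_mono hsub

/-- The one-dimensional Brunn–Minkowski inequality. -/
theorem volume_add_le_volume_add {A B : Set ℝ} (hA : MeasurableSet A) (hB : MeasurableSet B)
    (hA' : A.Nonempty) (hB' : B.Nonempty) :
    volume A + volume B ≤ volume (A + B) := by
  obtain ⟨x, hx⟩ := hA'
  obtain ⟨y, hy⟩ := hB'
  have key : ∀ K ⊆ A, IsCompact K → ∀ L ⊆ B, IsCompact L →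
      volume K + volume L ≤ volume (A + B) := fun K hKA hK L hLB hL =>
    calc volume K + volume L ≤ volume (insert x K) + volume (insert y L) := by
          gcongr <;> exact Set.subset_insert _ _
      _ ≤ volume (insert x K + insert y L) := volume_add_le_volume_add_of_isCompact
          (hK.insert x) (hL.insert y) (Set.insert_nonempty _ _) (Set.insert_nonempty _ _)
      _ ≤ volume (A + B) := measure_mono <|
          Set.add_subset_add (Set.insert_subset hx hKA) (Set.insert_subset hy hLB)
  rw [hA.measure_eq_iSup_isCompact, hB.measure_eq_iSup_isCompact]
  simp_rw [iSup_and']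
  exact ENNReal.biSup_add_biSup_le' ⟨∅, by simp⟩ ⟨∅, by simp⟩
    fun K hK L hL => key K hK.1 hK.2 L hL.1 hL.2

theorem ENNReal.geom_mean_le_arith_mean2_weighted {a b : ℝ} (ha : 0 < a) (hb : 0 < b)
    (hab : a + b = 1) (x y : ℝ≥0∞) :
    x ^ a * y ^ b ≤ ENNReal.ofReal a * x + ENNReal.ofReal b * y := by
  have := ENNReal.young_inequality (x ^ a) (y ^ b) (p := a⁻¹) (q := b⁻¹)
    ⟨by simpa using hab, by positivity, by positivity⟩
  rwa [← ENNReal.rpow_mul, ← ENNReal.rpow_mul, mul_inv_cancel₀ ha.ne', mul_inv_cancel₀ hb.ne',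
    ENNReal.rpow_one, ENNReal.rpow_one, ENNReal.ofReal_inv_of_pos ha, ENNReal.ofReal_inv_of_pos hb,
    ENNReal.div_eq_inv_mul, ENNReal.div_eq_inv_mul, inv_inv, inv_inv] at this

/-- A measure on a real vector space satisfies the Prékopa–Leindler inequality. -/
def IsPrekopaLeindler {E : Type*} [AddCommGroup E] [Module ℝ E] [MeasurableSpace E]
    (μ : Measure E) : Prop :=
  ∀ ⦃a b : ℝ⦄, 0 < a → 0 < b → a + b = 1 → ∀ ⦃u v h : E → ℝ≥0∞⦄,
    Measurable u → Measurable v → Measurable h →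
    (∀ x y, u x ^ a * v y ^ b ≤ h (a • x + b • y)) →
    (∫⁻ x, u x ∂μ) ^ a * (∫⁻ x, v x ∂μ) ^ b ≤ ∫⁻ x, h x ∂μ

theorem IsPrekopaLeindler.of_measurePreserving {E F : Type*} [AddCommGroup E] [Module ℝ E]
    [MeasurableSpace E] [AddCommGroup F] [Module ℝ F] [MeasurableSpace F] {μ : Measure E}
    {ν : Measure F} (hμ : IsPrekopaLeindler μ) (e : E → F) (he : MeasurePreserving e μ ν)
    (hlin : ∀ (a b : ℝ) x y, e (a • x + b • y) = a • e x + b • e y) : IsPrekopaLeindler ν := by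
  intro a b ha hb hab u v h hu hv hh huvh
  rw [← he.lintegral_comp hu, ← he.lintegral_comp hv, ← he.lintegral_comp hh]
  refine hμ ha hb hab (hu.comp he.measurable) (hv.comp he.measurable) (hh.comp he.measurable) ?_
  intro x y
  rw [hlin]
  exact huvh _ _

theorem IsPrekopaLeindler.prod {E F : Type*} [AddCommGroup E] [Module ℝ E]
    [MeasurableSpace E] [AddCommGroup F] [Module ℝ F] [MeasurableSpace F] {μ : Measure E}
    {ν : Measure F} [SFinite ν] (hμ : IsPrekopaLeindler μ) (hν : IsPrekopaLeindler ν) :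
    IsPrekopaLeindler (μ.prod ν) := by
  intro a b ha hb hab u v h hu hv hh huvh
  rw [lintegral_prod _ hu.aemeasurable, lintegral_prod _ hv.aemeasurable,
    lintegral_prod _ hh.aemeasurable]
  refine hμ ha hb hab hu.lintegral_prod_right' hv.lintegral_prod_right'
    hh.lintegral_prod_right' fun x y => ?_
  refine hν ha hb hab (hu.comp measurable_prodMk_left) (hv.comp measurable_prodMk_left)
    (hh.comp measurable_prodMk_left) fun x' y' => ?_
  exact huvh (x, x') (y, y')

theorem ofReal_mul_volume_add_le {a b : ℝ} (ha : 0 < a) (hb : 0 < b) {A B C : Set ℝ}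
    (hA : MeasurableSet A) (hB : MeasurableSet B) (hA' : A.Nonempty) (hB' : B.Nonempty)
    (hC : ∀ x ∈ A, ∀ y ∈ B, a • x + b • y ∈ C) :
    ENNReal.ofReal a * volume A + ENNReal.ofReal b * volume B ≤ volume C := by
  have h := volume_add_le_volume_add (hA.const_smul₀ a) (hB.const_smul₀ b) (hA'.smul_set (a := a))
    (hB'.smul_set (a := b))
  rw [Measure.addHaar_smul_of_nonneg _ ha.le, Measure.addHaar_smul_of_nonneg _ hb.le] at h
  simp only [Module.finrank_self, pow_one] at h
  refine h.trans (measure_mono ?_)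
  rintro _ ⟨_, ⟨x, hx, rfl⟩, _, ⟨y, hy, rfl⟩, rfl⟩
  exact hC x hx y hy

theorem setLIntegral_Ioo_measure_lt {u : ℝ → ℝ≥0∞} (hu : Measurable u) (hu1 : ∀ x, u x ≤ 1) :
    ∫⁻ x, u x = ∫⁻ s in Set.Ioo (0 : ℝ) 1, volume {x | ENNReal.ofReal s < u x} := by
  have hfin : ∀ x, u x ≠ ∞ := fun x => ((hu1 x).trans_lt ENNReal.one_lt_top).ne
  have h := lintegral_eq_lintegral_meas_lt (volume : Measure ℝ) (f := fun x => (u x).toReal)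
    (Filter.Eventually.of_forall fun x => ENNReal.toReal_nonneg) hu.ennreal_toReal.aemeasurable
  simp only [ENNReal.ofReal_toReal (hfin _)] at h
  rw [h, ← lintegral_indicator measurableSet_Ioi, ← lintegral_indicator measurableSet_Ioo]
  congr 1
  ext s
  by_cases hs : s ∈ Set.Ioo (0 : ℝ) 1
  · rw [Set.indicator_of_mem hs, Set.indicator_of_mem (show s ∈ Set.Ioi (0 : ℝ) from hs.1)]
    simp only [ENNReal.ofReal_lt_iff_lt_toReal hs.1.le (hfin _)]
  · rw [Set.indicator_of_notMem hs]
    by_cases hs0 : 0 < s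
    · rw [Set.indicator_of_mem (show s ∈ Set.Ioi (0 : ℝ) from hs0)]
      have hs1 : 1 ≤ s := not_lt.1 fun h1 => hs ⟨hs0, h1⟩
      have : {x | s < (u x).toReal} = ∅ := Set.eq_empty_of_forall_notMem fun x hx =>
        (hs1.trans_lt hx).not_ge (ENNReal.toReal_mono ENNReal.one_ne_top (hu1 x))
      rw [this, measure_empty]
    · exact Set.indicator_of_notMem (show s ∉ Set.Ioi (0 : ℝ) from hs0) _

/-- The one-dimensional Prékopa–Leindler inequality for functions with supremum one. -/
theorem lintegral_rpow_mul_le_of_iSup_eq_one {a b : ℝ} (ha : 0 < a) (hb : 0 < b) (hab : a + b = 1)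
    {u v h : ℝ → ℝ≥0∞} (hu : Measurable u) (hv : Measurable v) (hh : Measurable h)
    (hu1 : ⨆ x, u x = 1) (hv1 : ⨆ x, v x = 1)
    (huvh : ∀ x y, u x ^ a * v y ^ b ≤ h (a • x + b • y)) :
    (∫⁻ x, u x) ^ a * (∫⁻ x, v x) ^ b ≤ ∫⁻ x, h x := by
  have hmin : Measurable fun x => min (h x) 1 := hh.min measurable_const
  have hlevel : ∀ s ∈ Set.Ioo (0 : ℝ) 1,
      ENNReal.ofReal a * volume {x | ENNReal.ofReal s < u x} +
        ENNReal.ofReal b * volume {x | ENNReal.ofReal s < v x} ≤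
      volume {x | ENNReal.ofReal s < min (h x) 1} := by
    intro s hs
    have hs1 : ENNReal.ofReal s < 1 := by simpa using hs.2
    have hne : ∀ w : ℝ → ℝ≥0∞, ⨆ x, w x = 1 → {x | ENNReal.ofReal s < w x}.Nonempty :=
      fun w hw => by
        obtain ⟨x, hx⟩ := lt_iSup_iff.1 (hs1.trans_eq hw.symm)
        exact ⟨x, hx⟩
    refine ofReal_mul_volume_add_le ha hb (measurableSet_lt measurable_const hu)
      (measurableSet_lt measurable_const hv) (hne u hu1) (hne v hv1)
      fun x hx y hy => lt_min ?_ hs1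
    calc ENNReal.ofReal s = ENNReal.ofReal s ^ a * ENNReal.ofReal s ^ b := by
          rw [← ENNReal.rpow_add_of_nonneg _ _ ha.le hb.le, hab, ENNReal.rpow_one]
      _ < u x ^ a * v y ^ b := ENNReal.mul_lt_mul (ENNReal.rpow_lt_rpow hx ha)
          (ENNReal.rpow_lt_rpow hy hb)
      _ ≤ _ := huvh x y
  have hanti : ∀ w : ℝ → ℝ≥0∞, Measurable fun s : ℝ => volume {x | ENNReal.ofReal s < w x} :=
    fun w => Antitone.measurable fun s r hsr => measure_mono fun x hx =>
      (ENNReal.ofReal_le_ofReal hsr).trans_lt hx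
  calc (∫⁻ x, u x) ^ a * (∫⁻ x, v x) ^ b
      ≤ ENNReal.ofReal a * (∫⁻ x, u x) + ENNReal.ofReal b * ∫⁻ x, v x :=
        ENNReal.geom_mean_le_arith_mean2_weighted ha hb hab _ _
    _ = ∫⁻ s in Set.Ioo (0 : ℝ) 1, (ENNReal.ofReal a * volume {x | ENNReal.ofReal s < u x} +
        ENNReal.ofReal b * volume {x | ENNReal.ofReal s < v x}) := by
        rw [lintegral_add_left ((hanti u).const_mul _), lintegral_const_mul _ (hanti u),
          lintegral_const_mul _ (hanti v), setLIntegral_Ioo_measure_lt hu fun x => hu1 ▸ le_iSup u x,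
          setLIntegral_Ioo_measure_lt hv fun x => hv1 ▸ le_iSup v x]
    _ ≤ ∫⁻ s in Set.Ioo (0 : ℝ) 1, volume {x | ENNReal.ofReal s < min (h x) 1} :=
        setLIntegral_mono' measurableSet_Ioo hlevel
    _ = ∫⁻ x, min (h x) 1 := (setLIntegral_Ioo_measure_lt hmin fun x => min_le_right _ _).symm
    _ ≤ ∫⁻ x, h x := lintegral_mono fun x => min_le_left _ _

theorem lintegral_rpow_mul_le_of_iSup_ne_top {a b : ℝ} (ha : 0 < a) (hb : 0 < b) (hab : a + b = 1)
    {u v h : ℝ → ℝ≥0∞} (hu : Measurable u) (hv : Measurable v) (hh : Measurable h)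
    (hu1 : ⨆ x, u x ≠ ∞) (hv1 : ⨆ x, v x ≠ ∞)
    (huvh : ∀ x y, u x ^ a * v y ^ b ≤ h (a • x + b • y)) :
    (∫⁻ x, u x) ^ a * (∫⁻ x, v x) ^ b ≤ ∫⁻ x, h x := by
  rcases eq_or_ne (⨆ x, u x) 0 with hU | hU
  · simp [ENNReal.iSup_eq_zero.1 hU, ha]
  rcases eq_or_ne (⨆ x, v x) 0 with hV | hV
  · simp [ENNReal.iSup_eq_zero.1 hV, hb]
  set U := ⨆ x, u x
  set V := ⨆ x, v x
  have hc0 : U ^ a * V ^ b ≠ 0 := by simp [hU, hV, hu1, hv1]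
  have hctop : U ^ a * V ^ b ≠ ∞ := ENNReal.mul_ne_top (by simp [hU, hu1]) (by simp [hV, hv1])
  have hdiv : ∀ x y : ℝ≥0∞, (x / U) ^ a * (y / V) ^ b = x ^ a * y ^ b / (U ^ a * V ^ b) := by
    intro x y
    rw [ENNReal.div_rpow_of_nonneg _ _ ha.le, ENNReal.div_rpow_of_nonneg _ _ hb.le,
      div_eq_mul_inv, div_eq_mul_inv, div_eq_mul_inv,
      ENNReal.mul_inv (.inr (by simp [hV, hv1])) (.inr (by simp [hV, hv1]))]
    ring
  have := lintegral_rpow_mul_le_of_iSup_eq_one ha hb hab (u := fun x => u x / U)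
    (v := fun x => v x / V) (h := fun x => h x / (U ^ a * V ^ b)) (hu.div_const _) (hv.div_const _)
    (hh.div_const _) (by rw [← ENNReal.iSup_div, ENNReal.div_self hU hu1])
    (by rw [← ENNReal.iSup_div, ENNReal.div_self hV hv1])
    fun x y => by rw [hdiv]; exact ENNReal.div_le_div_right (huvh x y) _
  simp only [div_eq_mul_inv] at this hdiv
  rw [lintegral_mul_const _ hu, lintegral_mul_const _ hv, lintegral_mul_const _ hh, hdiv] at this
  exact (ENNReal.mul_le_mul_iff_left (ENNReal.inv_ne_zero.2 hctop) (ENNReal.inv_ne_top.2 hc0)).1 this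

theorem lintegral_eq_iSup_lintegral_min {u : ℝ → ℝ≥0∞} (hu : Measurable u) :
    ∫⁻ x, u x = ⨆ n : ℕ, ∫⁻ x, min (u x) n := by
  rw [← lintegral_iSup (fun n => hu.min measurable_const)
    fun m n hmn x => min_le_min_left _ (by exact_mod_cast hmn)]
  congr 1
  ext x
  rw [← inf_iSup_eq, ENNReal.iSup_natCast, inf_top_eq]

theorem isPrekopaLeindler_volume_real : IsPrekopaLeindler (volume : Measure ℝ) := by
  intro a b ha hb hab u v h hu hv hh huvh
  rw [lintegral_eq_iSup_lintegral_min hu, lintegral_eq_iSup_lintegral_min hv,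
    ← ENNReal.orderIsoRpow_apply _ ha, ← ENNReal.orderIsoRpow_apply _ hb,
    OrderIso.map_iSup, OrderIso.map_iSup, ENNReal.iSup_mul]
  simp only [ENNReal.mul_iSup, ENNReal.orderIsoRpow_apply]
  refine iSup₂_le fun n m => ?_
  have htop : ∀ (w : ℝ → ℝ≥0∞) (k : ℕ), ⨆ x, min (w x) k ≠ ∞ := fun w k =>
    ne_top_of_le_ne_top (ENNReal.natCast_ne_top k) (iSup_le fun x => min_le_right _ _)
  refine lintegral_rpow_mul_le_of_iSup_ne_top ha hb hab (hu.min measurable_const)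
    (hv.min measurable_const) hh (htop u n) (htop v m) fun x y => le_trans ?_ (huvh x y)
  gcongr <;> exact min_le_left _ _

theorem isPrekopaLeindler_volume_pi (d : ℕ) :
    IsPrekopaLeindler (volume : Measure (Fin d → ℝ)) := by
  induction d with
  | zero =>
    intro a b ha hb hab u v h hu hv hh huvh
    rw [Measure.volume_pi_eq_dirac 0, lintegral_dirac, lintegral_dirac, lintegral_dirac]
    simpa using huvh 0 0
  | succ n ih =>
    refine (isPrekopaLeindler_volume_real.prod ih).of_measurePreserving _
      (volume_preserving_piFinSuccAbove (fun _ => ℝ) 0).symm fun a b x y => ?_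
    ext i
    refine Fin.cases ?_ (fun j => ?_) i <;> simp [MeasurableEquiv.piFinSuccAbove]

theorem isPrekopaLeindler_volume_euclideanSpace (d : ℕ) :
    IsPrekopaLeindler (volume : Measure (EuclideanSpace ℝ (Fin d))) :=
  (isPrekopaLeindler_volume_pi d).of_measurePreserving _ (PiLp.volume_preserving_toLp (Fin d))
    fun _ _ _ _ => rfl

theorem IsPrekopaLeindler.neg_log_integral_exp_le {E : Type*} [AddCommGroup E] [Module ℝ E]
    [MeasurableSpace E] {μ : Measure E} [NeZero μ] (hμ : IsPrekopaLeindler μ) {a b c : ℝ}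
    (ha : 0 < a) (hb : 0 < b) (hab : a + b = 1) {F G H : E → ℝ} (hF : Measurable F)
    (hG : Measurable G) (hH : Measurable H) (hFint : Integrable (fun x => exp (-F x)) μ)
    (hGint : Integrable (fun x => exp (-G x)) μ) (hHint : Integrable (fun x => exp (-H x)) μ)
    (hFGH : ∀ x y, H (a • x + b • y) ≤ a * F x + b * G y + c) :
    -log (∫ x, exp (-H x) ∂μ) ≤
      a * -log (∫ x, exp (-F x) ∂μ) + b * -log (∫ x, exp (-G x) ∂μ) + c := by
  have hFpos := integral_exp_pos hFint
  have hGpos := integral_exp_pos hGint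
  have hHpos := integral_exp_pos hHint
  have hlin : ∀ {K : E → ℝ}, Integrable (fun x => exp (-K x)) μ →
      ∫⁻ x, ENNReal.ofReal (exp (-K x)) ∂μ = ENNReal.ofReal (∫ x, exp (-K x) ∂μ) := fun hK =>
    (ofReal_integral_eq_lintegral_ofReal hK (ae_of_all _ fun _ => (exp_pos _).le)).symm
  have key := hμ ha hb hab (u := fun x => ENNReal.ofReal (exp (-F x)))
    (v := fun x => ENNReal.ofReal (exp (-G x)))
    (h := fun x => ENNReal.ofReal (exp c) * ENNReal.ofReal (exp (-H x)))
    (by fun_prop) (by fun_prop) (by fun_prop) fun x y => by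
      rw [ENNReal.ofReal_rpow_of_pos (exp_pos _), ENNReal.ofReal_rpow_of_pos (exp_pos _),
        ← ENNReal.ofReal_mul (by positivity), ← ENNReal.ofReal_mul (by positivity),
        ← exp_mul, ← exp_mul, ← exp_add, ← exp_add]
      refine ENNReal.ofReal_le_ofReal (exp_le_exp.2 ?_)
      linarith [hFGH x y]
  rw [lintegral_const_mul _ (by fun_prop), hlin hFint, hlin hGint, hlin hHint,
    ENNReal.ofReal_rpow_of_pos hFpos, ENNReal.ofReal_rpow_of_pos hGpos,
    ← ENNReal.ofReal_mul (by positivity), ← ENNReal.ofReal_mul (by positivity),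
    ENNReal.ofReal_le_ofReal_iff (by positivity)] at key
  have hlog := log_le_log (by positivity) key
  rw [log_mul (by positivity) (by positivity), log_mul (by positivity) (by positivity),
    log_rpow hFpos, log_rpow hGpos, log_exp] at hlog
  linarith

theorem norm_add_sq_le_weighted {E : Type*} [NormedAddCommGroup E] {α s : ℝ} (hα : 0 < α)
    (hs : 0 < s) (p q : E) :
    α / (1 + s * α) * ‖p + q‖ ^ 2 ≤ α * ‖p‖ ^ 2 + ‖q‖ ^ 2 / s := by
  have h1 : ‖p + q‖ ^ 2 ≤ (‖p‖ + ‖q‖) ^ 2 := by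
    gcongr
    exact norm_add_le p q
  refine (mul_le_mul_of_nonneg_left h1 (by positivity)).trans ?_
  rw [div_mul_eq_mul_div, div_le_iff₀ (by positivity), ← sub_nonneg]
  have : (α * ‖p‖ ^ 2 + ‖q‖ ^ 2 / s) * (1 + s * α) - α * (‖p‖ + ‖q‖) ^ 2 =
      (s * α * ‖p‖ - ‖q‖) ^ 2 / s := by
    field_simp
    ring
  rw [this]
  positivity

theorem norm_smul_add_smul_sq {E : Type*} [NormedAddCommGroup E] [InnerProductSpace ℝ E]
    {a b : ℝ} (hab : a + b = 1) (p q : E) :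
    ‖a • p + b • q‖ ^ 2 = a * ‖p‖ ^ 2 + b * ‖q‖ ^ 2 - a * b * ‖p - q‖ ^ 2 := by
  obtain rfl : b = 1 - a := by linarith
  rw [norm_add_sq_real, norm_sub_sq_real, norm_smul, norm_smul, inner_smul_left, inner_smul_right,
    mul_pow, mul_pow, norm_eq_abs, norm_eq_abs, sq_abs, sq_abs]
  simp only [conj_trivial]
  ring

theorem StrongConvexOn.neg_log_integral_exp_sub_sq {d : ℕ} {s α : ℝ} (hs : 0 < s) (hα : 0 < α)
    {f : EuclideanSpace ℝ (Fin d) → ℝ} (hf : StrongConvexOn Set.univ α f)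
    (hint : ∀ z, Integrable fun x => exp (-f x - ‖z - x‖ ^ 2 / (2 * s))) :
    StrongConvexOn Set.univ (α / (1 + s * α))
      (fun z => -log (∫ x, exp (-f x - ‖z - x‖ ^ 2 / (2 * s)))) := by
  have hcont : Continuous f :=
    (UniformConvexOn.convexOn hf fun r => by positivity).locallyLipschitz.continuous
  have hneg : ∀ z x, -f x - ‖z - x‖ ^ 2 / (2 * s) = -(f x + ‖z - x‖ ^ 2 / (2 * s)) :=
    fun z x => by ring
  simp only [hneg] at hint ⊢
  refine ⟨convex_univ, fun z _ w _ a b ha hb hab => ?_⟩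
  rcases ha.eq_or_lt with rfl | ha
  · obtain rfl : b = 1 := by linarith
    simp
  rcases hb.eq_or_lt with rfl | hb
  · obtain rfl : a = 1 := by linarith
    simp
  have hmeas : ∀ z, Measurable fun x => f x + ‖z - x‖ ^ 2 / (2 * s) := fun z =>
    Continuous.measurable (by fun_prop)
  have := (isPrekopaLeindler_volume_euclideanSpace d).neg_log_integral_exp_le ha hb hab
    (c := -(a * b * (α / (1 + s * α) / 2 * ‖z - w‖ ^ 2)))
    (hmeas z) (hmeas w) (hmeas (a • z + b • w)) (hint z) (hint w) (hint _) fun x y => by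
      have h1 := hf.2 (Set.mem_univ x) (Set.mem_univ y) ha.le hb.le hab
      have h2 := norm_smul_add_smul_sq hab (z - x) (w - y)
      have h3 := norm_add_sq_le_weighted hα hs (x - y) ((z - x) - (w - y))
      rw [show x - y + (z - x - (w - y)) = z - w by abel] at h3
      rw [show a • z + b • w - (a • x + b • y) = a • (z - x) + b • (w - y) by module, h2]
      have h4 := mul_le_mul_of_nonneg_left h3 (mul_pos ha hb).le
      simp only [smul_eq_mul] at h1
      have h5 : (a * ‖z - x‖ ^ 2 + b * ‖w - y‖ ^ 2 - a * b * ‖z - x - (w - y)‖ ^ 2) / (2 * s) =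
          a * (‖z - x‖ ^ 2 / (2 * s)) + b * (‖w - y‖ ^ 2 / (2 * s)) -
            a * b * (‖z - x - (w - y)‖ ^ 2 / s) / 2 := by
        field_simp
      rw [h5]
      linarith
  simp only [smul_eq_mul]
  linarith

theorem MeasureTheory.Integrable.exp_sub_sq {E : Type*} [NormedAddCommGroup E] [MeasurableSpace E]
    [OpensMeasurableSpace E] [SecondCountableTopology E] {μ : Measure E} {f : E → ℝ}
    (hf : Integrable (fun x => exp (-f x)) μ) {s : ℝ} (hs : 0 < s) (z : E) :
    Integrable (fun x => exp (-f x - ‖z - x‖ ^ 2 / (2 * s))) μ := by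
  simp only [sub_eq_add_neg (-f _), exp_add]
  refine hf.mul_bdd (c := 1) (Continuous.aestronglyMeasurable (by fun_prop))
    (ae_of_all _ fun x => ?_)
  rw [norm_of_nonneg (exp_pos _).le, exp_le_one_iff, neg_nonpos]
  positivity

/-- for `f` `α_f`-strongly convex, `g` `α_g`-strongly convex, `η > 0` and
`t ∈ (0,1)`, the function `z ↦ −log(φ_t(z) φ̂_t(z))`, where
`φ_t(z) = ∫ exp(−g(y) − ‖z−y‖²/(2η(1−t))) dy` and
`φ̂_t(z) = ∫ exp(−f(x) − ‖z−x‖²/(2ηt)) dx`, is strongly convex with constant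
`α_f/(1 + ηtα_f) + α_g/(1 + η(1−t)α_g)`. -/
theorem neg_log_phi_mul_phiHat_strongConvexOn
    (d : ℕ) (hd : 1 ≤ d) (η : ℝ) (hη : 0 < η) (t : ℝ) (ht : t ∈ Set.Ioo (0 : ℝ) 1)
    (f g : EuclideanSpace ℝ (Fin d) → ℝ) (αf αg : ℝ) (hαf : 0 < αf) (hαg : 0 < αg)
    (hf : StrongConvexOn Set.univ αf f) (hg : StrongConvexOn Set.univ αg g)
    (hfint : Integrable (fun x => Real.exp (-f x)))
    (hgint : Integrable (fun y => Real.exp (-g y))) :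
    StrongConvexOn Set.univ (αf / (1 + η * t * αf) + αg / (1 + η * (1 - t) * αg))
      (fun z : EuclideanSpace ℝ (Fin d) => - Real.log
        ((∫ y, Real.exp (-g y - ‖z - y‖ ^ 2 / (2 * η * (1 - t)))) *
         (∫ x, Real.exp (-f x - ‖z - x‖ ^ 2 / (2 * η * t))))) := by
  obtain ⟨ht0, ht1⟩ := ht
  have hs : 0 < η * t := mul_pos hη ht0
  have hs' : 0 < η * (1 - t) := mul_pos hη (sub_pos.2 ht1)
  simp only [mul_assoc 2 η]
  have hF := hf.neg_log_integral_exp_sub_sq hs hαf (hfint.exp_sub_sq hs)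
  have hG := hg.neg_log_integral_exp_sub_sq hs' hαg (hgint.exp_sub_sq hs')
  have hsum := UniformConvexOn.add hF hG
  unfold StrongConvexOn
  convert hsum using 1
  · ext r
    simp only [Pi.add_apply]
    ring
  · ext z
    rw [log_mul (integral_exp_pos (hgint.exp_sub_sq hs' z)).ne'
      (integral_exp_pos (hfint.exp_sub_sq hs z)).ne', Pi.add_apply]
    ring

end
end

section
/- (Asymptotic convergence of the X-marginal to the composite distribution.) Let d ≥ 1 and let f, g : ℝ^d → ℝ be measurable with exp(−g) ∈ L¹(ℝ^d), exp(−f) essentially bounded from above, and exp(−f−g) integrable with ∫ exp(−f(x)−g(x)) dx > 0. For η > 0 let π_η^X be the probability measure on ℝ^d with density proportional to x ↦ ∫_{ℝ^d} exp(−f(x) − g(y) − ‖x−y‖²/(2η)) dy, and let ν be the probability measure with density proportional to x ↦ exp(−f(x) − g(x)). Then lim_{η → 0⁺} TV(π_η^X, ν) = 0. -/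
open MeasureTheory Real Filter

noncomputable section

variable (d : ℕ)

/-- The (normalized) density of the `X`-marginal `π_η^X` of the joint distribution
proportional to `exp(−f(x) − g(y) − ‖x−y‖²/(2η))`. -/
def margDens (f g : EuclideanSpace ℝ (Fin d) → ℝ) (η : ℝ)
    (x : EuclideanSpace ℝ (Fin d)) : ℝ :=
  (∫ y, Real.exp (-f x - g y - ‖x - y‖ ^ 2 / (2 * η))) /
    ∫ x', ∫ y, Real.exp (-f x' - g y - ‖x' - y‖ ^ 2 / (2 * η))

/-- The density of the composite distribution `ν ∝ exp(−f(x) − g(x))`. -/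
def compDens (f g : EuclideanSpace ℝ (Fin d) → ℝ)
    (x : EuclideanSpace ℝ (Fin d)) : ℝ :=
  Real.exp (-f x - g x) / ∫ x', Real.exp (-f x' - g x')

/-- Total variation distance between two densities: half their `L¹` distance. -/
def tvDistDens (p q : EuclideanSpace ℝ (Fin d) → ℝ) : ℝ :=
  (1 / 2) * ∫ x, |p x - q x|

/-- The `L¹` modulus of continuity of an integrable function is continuous. -/
theorem continuous_integral_norm_translate_sub {E : Type*} [NormedAddCommGroup E]
    [NormedSpace ℝ E] [FiniteDimensional ℝ E] [MeasurableSpace E] [BorelSpace E]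
    {μ : Measure E} [μ.IsAddHaarMeasure] {G : E → ℝ} (hG : Integrable G μ) :
    Continuous fun h => ∫ x, ‖G (x - h) - G x‖ ∂μ := by
  let T : E → C(E, E) :=
    (ContinuousMap.mk (fun p : E × E => p.2 - p.1) (by fun_prop)).curry
  have hT : Continuous T := ContinuousMap.continuous _
  have hTm : ∀ h, MeasurePreserving (T h) μ μ := fun h => measurePreserving_sub_right μ h
  have hF : MemLp G 1 μ := memLp_one_iff_integrable.2 hG
  have hcont : Continuous fun h =>
      ‖Lp.compMeasurePreserving (T h) (hTm h) (hF.toLp G) - hF.toLp G‖ :=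
    ((continuous_const.compMeasurePreservingLp hT hTm ENNReal.one_ne_top).sub
      continuous_const).norm
  refine hcont.congr fun h => ?_
  rw [L1.norm_eq_integral_norm]
  refine integral_congr_ae ?_
  filter_upwards [Lp.coeFn_sub (Lp.compMeasurePreserving (T h) (hTm h) (hF.toLp G)) (hF.toLp G),
    Lp.coeFn_compMeasurePreserving (hF.toLp G) (hTm h), hF.coeFn_toLp,
    (hTm h).quasiMeasurePreserving.ae_eq_comp hF.coeFn_toLp] with x h1 h2 h3 h4
  rw [h1, Pi.sub_apply, h2, h3, h4]
  rfl

theorem integrable_prod_translate_mul {E : Type*} [NormedAddCommGroup E]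
    [NormedSpace ℝ E] [FiniteDimensional ℝ E] [MeasurableSpace E] [BorelSpace E]
    {μ : Measure E} [μ.IsAddHaarMeasure] {G φ : E → ℝ} (hGm : Measurable G)
    (hφm : Measurable φ) (hG : Integrable G μ) (hφ : Integrable φ μ) (t : ℝ) :
    Integrable (fun p : E × E => G (p.1 - t • p.2) * φ p.2) (μ.prod μ) := by
  have hm : Measurable fun p : E × E => G (p.1 - t • p.2) * φ p.2 := by fun_prop
  rw [integrable_prod_iff' hm.aestronglyMeasurable]
  refine ⟨.of_forall fun z => (hG.comp_sub_right (t • z)).mul_const (φ z), ?_⟩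
  simp only [norm_mul, integral_mul_const]
  simp only [integral_sub_right_eq_self (fun x => ‖G x‖)]
  exact hφ.norm.const_mul _

/-- Averaging an integrable function against translates at scale `t` converges in `L¹`,
as `t → 0`, even after multiplication by a bounded weight. -/
theorem tendsto_integral_norm_weighted_average_sub {E : Type*} [NormedAddCommGroup E]
    [NormedSpace ℝ E] [FiniteDimensional ℝ E] [MeasurableSpace E] [BorelSpace E]
    {μ : Measure E} [μ.IsAddHaarMeasure] {G φ w : E → ℝ} {M : ℝ} (hGm : Measurable G)
    (hφm : Measurable φ) (hG : Integrable G μ) (hφ : Integrable φ μ)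
    (hwM : ∀ᵐ x ∂μ, ‖w x‖ ≤ M) :
    Tendsto (fun t : ℝ => ∫ x, ‖w x * (∫ z, G (x - t • z) * φ z ∂μ)
      - w x * (G x * ∫ z, φ z ∂μ)‖ ∂μ) (nhds 0) (nhds 0) := by
  set D : E → ℝ := fun h => ∫ x, ‖G (x - h) - G x‖ ∂μ with hD
  have hDc : Continuous D := continuous_integral_norm_translate_sub hG
  have hD0 : ∀ h, 0 ≤ D h := fun h => integral_nonneg fun x => norm_nonneg _
  have hDle : ∀ h, D h ≤ 2 * ∫ x, ‖G x‖ ∂μ := fun h => by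
    calc D h ≤ ∫ x, (‖G (x - h)‖ + ‖G x‖) ∂μ :=
          integral_mono ((hG.comp_sub_right h).sub hG).norm
            ((hG.comp_sub_right h).norm.add hG.norm) fun x => norm_sub_le _ _
      _ = 2 * ∫ x, ‖G x‖ ∂μ := by
          rw [integral_add (hG.comp_sub_right h).norm hG.norm,
            integral_sub_right_eq_self (fun x => ‖G x‖)]
          ring
  have hlim : Tendsto (fun t : ℝ => M * ∫ z, D (t • z) * ‖φ z‖ ∂μ) (nhds 0) (nhds 0) := by
    have h0 : D 0 = 0 := by simp [hD]
    have : Tendsto (fun t : ℝ => ∫ z, D (t • z) * ‖φ z‖ ∂μ) (nhds 0)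
        (nhds (∫ z, D ((0 : ℝ) • z) * ‖φ z‖ ∂μ)) := by
      refine tendsto_integral_filter_of_dominated_convergence
        (fun z => (2 * ∫ x, ‖G x‖ ∂μ) * ‖φ z‖) (.of_forall fun t => ?_)
        (.of_forall fun t => .of_forall fun z => ?_) (hφ.norm.const_mul _)
        (.of_forall fun z => ?_)
      · have : Continuous fun z => D (t • z) := by fun_prop
        exact (this.measurable.mul hφm.norm).aestronglyMeasurable
      · rw [norm_mul, norm_norm, Real.norm_of_nonneg (hD0 _)]
        gcongr
        exact hDle _
      · have : Continuous fun t : ℝ => D (t • z) * ‖φ z‖ := by fun_prop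
        exact this.tendsto 0
    simpa [h0] using this.const_mul M
  refine squeeze_zero (fun t => integral_nonneg fun x => norm_nonneg _) (fun t => ?_) hlim
  have hint : Integrable (fun p : E × E => (G (p.1 - t • p.2) - G p.1) * φ p.2) (μ.prod μ) := by
    refine ((integrable_prod_translate_mul hGm hφm hG hφ t).sub
      (integrable_prod_translate_mul hGm hφm hG hφ 0)).congr (.of_forall fun p => ?_)
    simp [sub_mul]
  have hsections := (integrable_prod_translate_mul hGm hφm hG hφ t).prod_right_ae
  calc ∫ x, ‖w x * (∫ z, G (x - t • z) * φ z ∂μ) - w x * (G x * ∫ z, φ z ∂μ)‖ ∂μ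
      ≤ ∫ x, M * ∫ z, ‖(G (x - t • z) - G x) * φ z‖ ∂μ ∂μ := by
        refine integral_mono_of_nonneg (.of_forall fun x => norm_nonneg _)
          (hint.norm.integral_prod_left.const_mul M) ?_
        filter_upwards [hwM, hsections] with x hx hs
        have : (∫ z, G (x - t • z) * φ z ∂μ) - G x * ∫ z, φ z ∂μ
            = ∫ z, (G (x - t • z) - G x) * φ z ∂μ := by
          rw [← integral_const_mul, ← integral_sub hs (hφ.const_mul _)]
          simp only [sub_mul]
        rw [← mul_sub, this, norm_mul]
        have hM : 0 ≤ M := (norm_nonneg _).trans hx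
        gcongr
        exact norm_integral_le_integral_norm _
    _ = M * ∫ z, D (t • z) * ‖φ z‖ ∂μ := by
        rw [integral_const_mul, integral_integral_swap hint.norm]
        simp only [norm_mul, integral_mul_const, hD]

/-- Convergence in `L¹` of unnormalized densities implies convergence in `L¹` of the
normalized ones, provided that the limit has nonzero mass. -/
theorem tendsto_integral_abs_normalized_sub {α ι : Type*} [MeasurableSpace α] {μ : Measure α}
    {l : Filter ι} {u : ι → α → ℝ} {v : α → ℝ} (hu : ∀ i, Integrable (u i) μ)
    (hv : Integrable v μ) (hv0 : ∫ x, v x ∂μ ≠ 0)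
    (h : Tendsto (fun i => ∫ x, ‖u i x - v x‖ ∂μ) l (nhds 0)) :
    Tendsto (fun i => ∫ x, |u i x / (∫ y, u i y ∂μ) - v x / ∫ y, v y ∂μ| ∂μ) l (nhds 0) := by
  have hA : Tendsto (fun i => ∫ x, u i x ∂μ) l (nhds (∫ x, v x ∂μ)) := by
    rw [tendsto_iff_norm_sub_tendsto_zero]
    refine squeeze_zero (fun i => norm_nonneg _) (fun i => ?_) h
    rw [← integral_sub (hu i) hv]
    exact norm_integral_le_integral_norm _
  have hinv := hA.inv₀ hv0
  have hlim : Tendsto (fun i => (∫ x, ‖u i x - v x‖ ∂μ) * |(∫ x, u i x ∂μ)⁻¹|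
      + (∫ x, ‖v x‖ ∂μ) * |(∫ x, u i x ∂μ)⁻¹ - (∫ x, v x ∂μ)⁻¹|) l (nhds 0) := by
    simpa using (h.mul hinv.abs).add
      ((hinv.sub_const (∫ x, v x ∂μ)⁻¹).abs.const_mul (∫ x, ‖v x‖ ∂μ))
  refine squeeze_zero (fun i => integral_nonneg fun x => abs_nonneg _) (fun i => ?_) hlim
  have hdiff : Integrable (fun x => ‖u i x - v x‖) μ := ((hu i).sub hv).norm
  rw [← integral_mul_const, ← integral_mul_const, ← integral_add
    (hdiff.mul_const _) (hv.norm.mul_const _)]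
  refine integral_mono ((((hu i).div_const _).sub (hv.div_const _)).abs)
    ((hdiff.mul_const _).add (hv.norm.mul_const _)) fun x => ?_
  simp only [Real.norm_eq_abs, ← abs_mul]
  refine le_trans (le_of_eq ?_) (abs_add_le _ _)
  congr 1
  ring

theorem integrable_exp_neg_norm_sq_div_two {V : Type*} [NormedAddCommGroup V]
    [InnerProductSpace ℝ V] [FiniteDimensional ℝ V] [MeasurableSpace V] [BorelSpace V] :
    Integrable fun z : V => Real.exp (-‖z‖ ^ 2 / 2) := by
  have h := GaussianFourier.integrable_cexp_neg_mul_sq_norm_add (b := 1 / 2) (by norm_num) 0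
    (0 : V)
  refine h.norm.congr (.of_forall fun z => ?_)
  simp only [Complex.norm_exp]
  congr 1
  rw [show (-(1 / 2) * (‖z‖ : ℂ) ^ 2 + 0 * (inner ℝ (0 : V) z : ℂ))
    = ((-‖z‖ ^ 2 / 2 : ℝ) : ℂ) by push_cast; ring, Complex.ofReal_re]

/-- Rescaling by `√η` turns the Gaussian kernel of variance `η` into a fixed one. -/
theorem integral_exp_neg_sub_sq_eq {d : ℕ} (f g : EuclideanSpace ℝ (Fin d) → ℝ) {η : ℝ}
    (hη : 0 < η) (x : EuclideanSpace ℝ (Fin d)) :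
    ∫ y, Real.exp (-f x - g y - ‖x - y‖ ^ 2 / (2 * η)) =
      √η ^ d * (Real.exp (-f x) *
        ∫ z, Real.exp (-g (x - √η • z)) * Real.exp (-‖z‖ ^ 2 / 2)) := by
  have hs : 0 < √η := Real.sqrt_pos.2 hη
  have hscale := Measure.integral_comp_smul (volume : Measure (EuclideanSpace ℝ (Fin d)))
    (fun y => Real.exp (-g (x - y)) * Real.exp (-‖y‖ ^ 2 / (2 * η))) √η
  have hker : ∀ z : EuclideanSpace ℝ (Fin d), -‖√η • z‖ ^ 2 / (2 * η) = -‖z‖ ^ 2 / 2 := by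
    intro z
    rw [norm_smul, mul_pow, Real.norm_of_nonneg hs.le, Real.sq_sqrt hη.le]
    field_simp
  simp only [hker] at hscale
  rw [hscale, finrank_euclideanSpace_fin, abs_of_pos (by positivity), smul_eq_mul,
    mul_left_comm (Real.exp _), mul_inv_cancel_left₀ (by positivity),
    ← integral_sub_left_eq_self _ volume x, ← integral_const_mul]
  refine integral_congr_ae (.of_forall fun y => ?_)
  simp only [sub_sub_cancel, ← Real.exp_add]
  congr 1
  ring

/-- asymptotic convergence of the `X`-marginal to the composite
distribution: `TV(π_η^X, ν) → 0` as `η → 0⁺`. -/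
theorem tv_marg_tendsto_composite
    (hd : 1 ≤ d)
    (f g : EuclideanSpace ℝ (Fin d) → ℝ)
    (hfmeas : Measurable f) (hgmeas : Measurable g)
    (hgint : Integrable (fun y => Real.exp (-g y)))
    (hfbdd : ∃ M : ℝ, ∀ᵐ x : EuclideanSpace ℝ (Fin d), Real.exp (-f x) ≤ M)
    (hfgint : Integrable (fun x => Real.exp (-f x - g x)))
    (hfgpos : 0 < ∫ x, Real.exp (-f x - g x)) :
    Tendsto (fun η => tvDistDens d (margDens d f g η) (compDens d f g))
      (nhdsWithin 0 (Set.Ioi 0)) (nhds 0) := by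
  obtain ⟨M, hM⟩ := hfbdd
  let φ : EuclideanSpace ℝ (Fin d) → ℝ := fun z => Real.exp (-‖z‖ ^ 2 / 2)
  let u : ℝ → EuclideanSpace ℝ (Fin d) → ℝ := fun t x =>
    Real.exp (-f x) * ∫ z, Real.exp (-g (x - t • z)) * φ z
  let v : EuclideanSpace ℝ (Fin d) → ℝ := fun x =>
    Real.exp (-f x) * (Real.exp (-g x) * ∫ z, φ z)
  have hφ : Integrable φ := integrable_exp_neg_norm_sq_div_two
  have hφm : Measurable φ := by fun_prop
  have hGm : Measurable fun y => Real.exp (-g y) := by fun_prop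
  have hwM : ∀ᵐ x, ‖Real.exp (-f x)‖ ≤ M := by simpa using hM
  have hC : 0 < ∫ z, φ z := integral_exp_pos hφ
  have hv_eq : ∀ x, v x = Real.exp (-f x - g x) * ∫ z, φ z := fun x => by
    simp only [v, sub_eq_add_neg, Real.exp_add, mul_assoc]
  have hv : Integrable v :=
    (hfgint.mul_const (∫ z, φ z)).congr (.of_forall fun x => (hv_eq x).symm)
  have hv_int : ∫ x, v x = (∫ x, Real.exp (-f x - g x)) * ∫ z, φ z := by
    simp only [hv_eq, integral_mul_const]
  have hu : ∀ t, Integrable (u t) := fun t =>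
    (integrable_prod_translate_mul hGm hφm hgint hφ t).integral_prod_left.bdd_mul
      (by fun_prop) hwM
  have hL1 : Tendsto (fun t => ∫ x, ‖u t x - v x‖) (nhds 0) (nhds 0) :=
    tendsto_integral_norm_weighted_average_sub (μ := volume) (G := fun y => Real.exp (-g y))
      (φ := φ) (w := fun x => Real.exp (-f x)) hGm hφm hgint hφ hwM
  have hv0 : ∫ x, v x ≠ 0 := by
    rw [hv_int]
    exact (mul_pos hfgpos hC).ne'
  have hlim := (tendsto_integral_abs_normalized_sub hu hv hv0 hL1).const_mul (1 / 2)
  rw [mul_zero] at hlim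
  have hsqrt : Tendsto (fun η : ℝ => √η) (nhdsWithin 0 (Set.Ioi 0)) (nhds 0) := by
    simpa using (Real.continuous_sqrt.tendsto 0).mono_left nhdsWithin_le_nhds
  refine (hlim.comp hsqrt).congr' ?_
  filter_upwards [self_mem_nhdsWithin] with η hη
  have hη : 0 < η := hη
  have hmarg : ∀ x, margDens d f g η x = u √η x / ∫ y, u √η y := fun x => by
    simp only [margDens, integral_exp_neg_sub_sq_eq f g hη, integral_const_mul]
    exact mul_div_mul_left _ _ (by positivity)
  have hcomp : ∀ x, compDens d f g x = v x / ∫ y, v y := fun x => by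
    rw [hv_int, hv_eq, mul_div_mul_right _ _ hC.ne', compDens]
  simp only [tvDistDens, hmarg, hcomp, Function.comp_apply]

end
end

section
/- (Non-asymptotic rate for a quadratic component.) Let d ≥ 1, σ > 0, u ∈ ℝ^d, η > 0. Let g(y) = ‖y − u‖²/(2σ²), and let f : ℝ^d → ℝ be α_f-strongly convex (α_f > 0), twice continuously differentiable, with ∇f(u) = 0 (so f and g share the minimizer u) and exp(−f) integrable. Let π_η^X be the probability measure with density proportional to x ↦ ∫_{ℝ^d} exp(−f(x) − g(y) − ‖x−y‖²/(2η)) dy, and let ν be the probability measure with density proportional to exp(−f(x) − g(x)). Then D_KL(ν ‖ π_η^X) ≤ d η² / (2 (α_f σ⁴ + σ²)²), and consequently TV(π_η^X, ν) ≤ η √d / (2 (α_f σ⁴ + σ²)). -/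
open MeasureTheory Real

noncomputable section

variable (d : ℕ)

/-- Kullback–Leibler divergence between two probability densities on `ℝ^d`. -/
def klDivDens (p q : EuclideanSpace ℝ (Fin d) → ℝ) : ℝ :=
  ∫ z, Real.log (p z / q z) * p z

/-- The density of the `X`-marginal `π_η^X` of the joint distribution proportional to
`exp(−f(x) − ‖y−u‖²/(2σ²) − ‖x−y‖²/(2η))`. -/
def quadMargDens (f : EuclideanSpace ℝ (Fin d) → ℝ) (u : EuclideanSpace ℝ (Fin d))
    (σ η : ℝ) (x : EuclideanSpace ℝ (Fin d)) : ℝ :=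
  (∫ y, Real.exp (-f x - ‖y - u‖ ^ 2 / (2 * σ ^ 2) - ‖x - y‖ ^ 2 / (2 * η))) /
    ∫ x', ∫ y, Real.exp (-f x' - ‖y - u‖ ^ 2 / (2 * σ ^ 2) - ‖x' - y‖ ^ 2 / (2 * η))

/-- The density of the composite distribution `ν ∝ exp(−f(x) − ‖x−u‖²/(2σ²))`. -/
def quadCompDens (f : EuclideanSpace ℝ (Fin d) → ℝ) (u : EuclideanSpace ℝ (Fin d))
    (σ : ℝ) (x : EuclideanSpace ℝ (Fin d)) : ℝ :=
  Real.exp (-f x - ‖x - u‖ ^ 2 / (2 * σ ^ 2)) /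
    ∫ x', Real.exp (-f x' - ‖x' - u‖ ^ 2 / (2 * σ ^ 2))

open Set in
/-- One-dimensional Brunn–Minkowski inequality. -/
lemma Real.volume_add_volume_le_of_add_mem {A B C : Set ℝ} (hA : MeasurableSet A)
    (hB : MeasurableSet B) (hA₀ : A.Nonempty) (hB₀ : B.Nonempty)
    (hC : ∀ x ∈ A, ∀ y ∈ B, x + y ∈ C) : volume A + volume B ≤ volume C := by
  by_cases hA' : volume A = 0
  · obtain ⟨x, hx⟩ := hA₀
    rw [hA', zero_add, ← measure_preimage_add volume x C]
    exact measure_mono fun y hy => hC x hx y hy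
  by_cases hB' : volume B = 0
  · obtain ⟨y, hy⟩ := hB₀
    rw [hB', add_zero, ← measure_preimage_add_right volume y C]
    exact measure_mono fun x hx => hC x hx y hy
  by_contra! hlt
  obtain ⟨p, hp, q, hq, hpq⟩ := ENNReal.exists_lt_add_of_lt_add hlt hA' hB'
  obtain ⟨K, hKA, hK, hpK⟩ := hA.exists_lt_isCompact hp
  obtain ⟨L, hLB, hL, hqL⟩ := hB.exists_lt_isCompact hq
  have hK₀ : K.Nonempty := nonempty_of_measure_ne_zero (pos_of_gt hpK).ne'
  have hL₀ : L.Nonempty := nonempty_of_measure_ne_zero (pos_of_gt hqL).ne'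
  have hsK := hK.sSup_mem hK₀
  have hiL := hL.sInf_mem hL₀
  set s := sSup K
  set i := sInf L
  have hle : volume K + volume L ≤ volume C := by
    have hK' : volume ((fun x => x + -i) ⁻¹' K) = volume K := measure_preimage_add_right _ _ _
    have hL' : volume ((fun x => x + -s) ⁻¹' L) = volume L := measure_preimage_add_right _ _ _
    have hLm : MeasurableSet ((fun x => x + -s) ⁻¹' L) :=
      (measurable_add_const (-s)) hL.measurableSet
    rw [← hK', ← hL', ← measure_sdiff_null (s := (fun x => x + -s) ⁻¹' L)
      (measure_singleton (s + i)), ← measure_union _ (hLm.diff (measurableSet_singleton _))]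
    · refine measure_mono ?_
      rintro z (hz | ⟨hz, -⟩)
      · have := hC _ (hKA hz) _ (hLB hiL)
        simpa using this
      · have := hC _ (hKA hsK) _ (hLB hz)
        simpa using this
    · rw [Set.disjoint_left]
      rintro z hz ⟨hz', hne⟩
      have h1 : z + -i ≤ s := le_csSup hK.bddAbove hz
      have h2 : i ≤ z + -s := csInf_le hL.bddBelow hz'
      exact hne (by simp only [mem_singleton_iff]; linarith)
  exact absurd (hpq.trans_le ((add_le_add hpK.le hqL.le).trans hle)) (lt_irrefl _)

lemma lintegral_eq_setLIntegral_Ioo_meas_lt {α : Type*} [MeasurableSpace α] (μ : Measure α)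
    {f : α → ENNReal} (hf : Measurable f) (hf1 : ∀ x, f x ≤ 1) :
    ∫⁻ x, f x ∂μ = ∫⁻ t in Set.Ioo (0 : ℝ) 1, μ {x | ENNReal.ofReal t < f x} := by
  have hfin : ∀ x, f x ≠ ⊤ := fun x => ((hf1 x).trans_lt ENNReal.one_lt_top).ne
  have h1 : ∫⁻ x, f x ∂μ = ∫⁻ x, ENNReal.ofReal (f x).toReal ∂μ :=
    lintegral_congr fun x => (ENNReal.ofReal_toReal (hfin x)).symm
  rw [h1, lintegral_eq_lintegral_meas_lt μ (Filter.Eventually.of_forall fun x =>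
    ENNReal.toReal_nonneg) hf.ennreal_toReal.aemeasurable,
    ← Set.Ioo_union_Ici_eq_Ioi (zero_lt_one' ℝ), lintegral_union measurableSet_Ici
      (Set.disjoint_left.2 fun x hx hx' => (hx.2.trans_le hx').false)]
  have h2 : ∫⁻ t in Set.Ici (1 : ℝ), μ {x | t < (f x).toReal} = 0 := by
    rw [← setLIntegral_congr_fun (f := fun _ => 0) measurableSet_Ici]
    · simp
    · intro t ht
      have : {x | t < (f x).toReal} = ∅ := by
        ext x
        have := ENNReal.toReal_mono ENNReal.one_ne_top (hf1 x)
        simpa using this.trans ht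
      simp [this]
  rw [h2, add_zero]
  refine setLIntegral_congr_fun measurableSet_Ioo fun t ht => ?_
  simp only [ENNReal.ofReal_lt_iff_lt_toReal ht.1.le (hfin _)]

section PrekopaLeindler

variable {a b : ℝ}

lemma prekopaLeindler_real_of_le_one (ha : 0 < a) (hb : 0 < b)
    {f g h : ℝ → ENNReal} (hf : Measurable f) (hg : Measurable g) (hh : Measurable h)
    (hf1 : ∀ x, f x ≤ 1) (hg1 : ∀ x, g x ≤ 1)
    (hf' : ∀ t < 1, ∃ x, t < f x) (hg' : ∀ t < 1, ∃ x, t < g x)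
    (H : ∀ x y t, t < f x → t < g y → t < h (a * x + b * y)) :
    ENNReal.ofReal a * (∫⁻ x, f x) + ENNReal.ofReal b * (∫⁻ x, g x) ≤ ∫⁻ x, h x := by
  have hm : Measurable fun x => min (h x) 1 := hh.min measurable_const
  have meas : ∀ f : ℝ → ENNReal, Measurable fun t : ℝ => volume {x | ENNReal.ofReal t < f x} :=
    fun f => Antitone.measurable fun s t hst => measure_mono fun x hx =>
      (ENNReal.ofReal_le_ofReal hst).trans_lt hx
  have scale : ∀ {c : ℝ}, 0 < c → ∀ S : Set ℝ,
      volume ((fun x => c⁻¹ * x) ⁻¹' S) = ENNReal.ofReal c * volume S := by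
    intro c hc S
    rw [Real.volume_preimage_mul_left (inv_ne_zero hc.ne'), inv_inv, abs_of_pos hc]
  calc _ = ∫⁻ t in Set.Ioo (0 : ℝ) 1, (ENNReal.ofReal a * volume {x | ENNReal.ofReal t < f x} +
          ENNReal.ofReal b * volume {x | ENNReal.ofReal t < g x}) := by
        rw [lintegral_add_left ((meas f).const_mul _), lintegral_const_mul _ (meas f),
          lintegral_const_mul _ (meas g), ← lintegral_eq_setLIntegral_Ioo_meas_lt _ hf hf1,
          ← lintegral_eq_setLIntegral_Ioo_meas_lt _ hg hg1]
    _ ≤ ∫⁻ t in Set.Ioo (0 : ℝ) 1, volume {x | ENNReal.ofReal t < min (h x) 1} := by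
        refine setLIntegral_mono (meas _) fun t ht => ?_
        have ht1 : ENNReal.ofReal t < 1 := by simpa using ht.2
        obtain ⟨x₀, hx₀⟩ := hf' _ ht1
        obtain ⟨y₀, hy₀⟩ := hg' _ ht1
        rw [← scale ha, ← scale hb]
        refine Real.volume_add_volume_le_of_add_mem
          ((measurable_const_mul a⁻¹) (measurableSet_lt measurable_const hf))
          ((measurable_const_mul b⁻¹) (measurableSet_lt measurable_const hg))
          ⟨a * x₀, ?_⟩ ⟨b * y₀, ?_⟩ fun x hx y hy => ?_
        · simpa [ha.ne'] using hx₀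
        · simpa [hb.ne'] using hy₀
        · have := H _ _ _ hx hy
          rw [mul_inv_cancel_left₀ ha.ne', mul_inv_cancel_left₀ hb.ne'] at this
          exact lt_min this ht1
    _ = ∫⁻ x, min (h x) 1 :=
        (lintegral_eq_setLIntegral_Ioo_meas_lt _ hm fun x => min_le_right _ _).symm
    _ ≤ ∫⁻ x, h x := lintegral_mono fun x => min_le_left _ _

lemma ENNReal.rpow_mul_rpow_self (ha : 0 < a) (hb : 0 < b) (hab : a + b = 1) (x : ENNReal) :
    x ^ a * x ^ b = x := by
  rw [← ENNReal.rpow_add_of_nonneg _ _ ha.le hb.le, hab, ENNReal.rpow_one]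

lemma prekopaLeindler_real_of_bounded (ha : 0 < a) (hb : 0 < b) (hab : a + b = 1)
    {f g h : ℝ → ENNReal} (hf : Measurable f) (hg : Measurable g) (hh : Measurable h)
    (hfb : ⨆ x, f x ≠ ⊤) (hgb : ⨆ x, g x ≠ ⊤)
    (H : ∀ x y, f x ^ a * g y ^ b ≤ h (a * x + b * y)) :
    (∫⁻ x, f x) ^ a * (∫⁻ x, g x) ^ b ≤ ∫⁻ x, h x := by
  set M := ⨆ x, f x with hM
  set N := ⨆ x, g x with hN
  by_cases hM0 : M = 0
  · have : ∀ x, f x = 0 := by simpa [hM] using hM0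
    simp [this, ha]
  by_cases hN0 : N = 0
  · have : ∀ x, g x = 0 := by simpa [hN] using hN0
    simp [this, hb]
  have hMa0 : M ^ a ≠ 0 := by simp [hM0, hfb]
  have hNb0 : N ^ b ≠ 0 := by simp [hN0, hgb]
  have hMat : M ^ a ≠ ⊤ := ENNReal.rpow_ne_top_of_nonneg ha.le hfb
  have hNbt : N ^ b ≠ ⊤ := ENNReal.rpow_ne_top_of_nonneg hb.le hgb
  have exists_gt : ∀ {k : ℝ → ENNReal}, ⨆ x, k x ≠ 0 → ⨆ x, k x ≠ ⊤ → ∀ t < 1,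
      ∃ x, t < k x / ⨆ x, k x := by
    intro k h0 ht t ht1
    have : t * ⨆ x, k x < ⨆ x, k x := by
      conv_rhs => rw [← one_mul (⨆ x, k x)]
      exact (ENNReal.mul_lt_mul_iff_left h0 ht).2 ht1
    obtain ⟨x, hx⟩ := lt_iSup_iff.1 this
    exact ⟨x, (ENNReal.lt_div_iff_mul_lt (.inl h0) (.inl ht)).2 hx⟩
  have key := prekopaLeindler_real_of_le_one ha hb (f := fun x => f x / M)
    (g := fun x => g x / N) (h := fun x => h x / (M ^ a * N ^ b))
    (hf.div_const _) (hg.div_const _) (hh.div_const _)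
    (fun x => ENNReal.div_le_of_le_mul (by rw [one_mul]; exact le_iSup f x))
    (fun x => ENNReal.div_le_of_le_mul (by rw [one_mul]; exact le_iSup g x))
    (exists_gt hM0 hfb) (exists_gt hN0 hgb) (by
      intro x y t hx hy
      refine (lt_min hx hy).trans_le ?_
      calc min (f x / M) (g y / N)
          = min (f x / M) (g y / N) ^ a * min (f x / M) (g y / N) ^ b :=
            (ENNReal.rpow_mul_rpow_self ha hb hab _).symm
        _ ≤ (f x / M) ^ a * (g y / N) ^ b := by
            gcongr
            · exact min_le_left _ _
            · exact min_le_right _ _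
        _ = f x ^ a * g y ^ b / (M ^ a * N ^ b) := by
            rw [ENNReal.div_rpow_of_nonneg _ _ ha.le, ENNReal.div_rpow_of_nonneg _ _ hb.le,
              ENNReal.mul_div_mul_comm (.inr hNbt) (.inr hNb0)]
        _ ≤ _ := by gcongr; exact H x y)
  have amgm : ∀ u v : ENNReal, u ^ a * v ^ b ≤ ENNReal.ofReal a * u + ENNReal.ofReal b * v := by
    intro u v
    have hpq : Real.HolderConjugate a⁻¹ b⁻¹ := by
      rw [Real.holderConjugate_iff]
      exact ⟨by rw [one_lt_inv₀ ha]; linarith, by simpa using hab⟩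
    have := ENNReal.young_inequality (u ^ a) (v ^ b) hpq
    rwa [← ENNReal.rpow_mul, ← ENNReal.rpow_mul, mul_inv_cancel₀ ha.ne', mul_inv_cancel₀ hb.ne',
      ENNReal.rpow_one, ENNReal.rpow_one, ENNReal.ofReal_inv_of_pos ha,
      ENNReal.ofReal_inv_of_pos hb, div_eq_mul_inv, div_eq_mul_inv, inv_inv, inv_inv,
      mul_comm u, mul_comm v] at this
  have key' := (amgm _ _).trans key
  simp only [div_eq_mul_inv] at key'
  rw [lintegral_mul_const _ hf, lintegral_mul_const _ hg, lintegral_mul_const _ hh,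
    ← div_eq_mul_inv, ← div_eq_mul_inv, ← div_eq_mul_inv,
    ENNReal.div_rpow_of_nonneg _ _ ha.le, ENNReal.div_rpow_of_nonneg _ _ hb.le,
    ← ENNReal.mul_div_mul_comm (.inr hNbt) (.inr hNb0)] at key'
  have h0 := mul_ne_zero hMa0 hNb0
  have ht := ENNReal.mul_ne_top hMat hNbt
  rwa [ENNReal.div_le_iff h0 ht, ENNReal.div_mul_cancel h0 ht] at key'

lemma prekopaLeindler_real (ha : 0 < a) (hb : 0 < b) (hab : a + b = 1)
    {f g h : ℝ → ENNReal} (hf : Measurable f) (hg : Measurable g) (hh : Measurable h)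
    (H : ∀ x y, f x ^ a * g y ^ b ≤ h (a * x + b * y)) :
    (∫⁻ x, f x) ^ a * (∫⁻ x, g x) ^ b ≤ ∫⁻ x, h x := by
  have trunc : ∀ {k : ℝ → ENNReal}, Measurable k → ∀ {c : ℝ}, 0 < c →
      (∫⁻ x, k x) ^ c = ⨆ n : ℕ, (∫⁻ x, min (k x) n) ^ c := by
    intro k hk c hc
    have h1 : ∫⁻ x, k x = ⨆ n : ℕ, ∫⁻ x, min (k x) n := by
      rw [← lintegral_iSup (fun n => hk.min measurable_const)
        (fun m n hmn x => min_le_min_left _ (by exact_mod_cast hmn))]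
      refine lintegral_congr fun x => ?_
      rw [← inf_iSup_eq (k x) (fun n : ℕ => (n : ENNReal)), ENNReal.iSup_natCast, inf_top_eq]
    rw [h1]
    exact (ENNReal.orderIsoRpow c hc).map_iSup _
  have bdd : ∀ (k : ℝ → ENNReal) (n : ℕ), ⨆ x, min (k x) n ≠ ⊤ := fun k n =>
    ((iSup_le fun x => min_le_right _ _).trans_lt (ENNReal.natCast_lt_top n)).ne
  rw [trunc hf ha, trunc hg hb, ENNReal.iSup_mul]
  refine iSup_le fun m => ?_
  rw [ENNReal.mul_iSup]
  refine iSup_le fun n => ?_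
  refine prekopaLeindler_real_of_bounded ha hb hab (hf.min measurable_const)
    (hg.min measurable_const) hh (bdd f m) (bdd g n) fun x y => le_trans ?_ (H x y)
  gcongr <;> exact min_le_left _ _

/-- The Prékopa–Leindler inequality on `Fin n → ℝ`. -/
lemma prekopaLeindler_pi (ha : 0 < a) (hb : 0 < b) (hab : a + b = 1) (n : ℕ)
    {f g h : (Fin n → ℝ) → ENNReal} (hf : Measurable f) (hg : Measurable g) (hh : Measurable h)
    (H : ∀ x y, f x ^ a * g y ^ b ≤ h (a • x + b • y)) :
    (∫⁻ x, f x) ^ a * (∫⁻ x, g x) ^ b ≤ ∫⁻ x, h x := by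
  induction n with
  | zero =>
    have : ∀ k : (Fin 0 → ℝ) → ENNReal, ∫⁻ x, k x = k 0 := fun k => by
      rw [lintegral_unique, volume_pi, Measure.pi_of_empty _ 0]
      rw [Measure.dirac_apply_of_mem (Set.mem_univ _), mul_one]
      exact congrArg k (Subsingleton.elim _ _)
    simpa [this] using H 0 0
  | succ n ih =>
    let e := MeasurableEquiv.piFinSuccAbove (fun _ : Fin (n + 1) => ℝ) 0
    have he : MeasurePreserving e.symm :=
      (volume_preserving_piFinSuccAbove (fun _ : Fin (n + 1) => ℝ) 0).symm _
    have split : ∀ {k : (Fin (n + 1) → ℝ) → ENNReal}, Measurable k →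
        ∫⁻ x, k x = ∫⁻ t, ∫⁻ y, k (e.symm (t, y)) := by
      intro k hk
      rw [← he.lintegral_comp hk]
      exact lintegral_prod _ (hk.comp e.symm.measurable).aemeasurable
    have meas : ∀ {k : (Fin (n + 1) → ℝ) → ENNReal}, Measurable k →
        Measurable fun t => ∫⁻ y, k (e.symm (t, y)) := fun hk =>
      (hk.comp e.symm.measurable).lintegral_prod_right'
    rw [split hf, split hg, split hh]
    refine prekopaLeindler_real ha hb hab (meas hf) (meas hg) (meas hh) fun s t => ?_
    refine ih ((hf.comp e.symm.measurable).comp measurable_prodMk_left)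
      ((hg.comp e.symm.measurable).comp measurable_prodMk_left)
      ((hh.comp e.symm.measurable).comp measurable_prodMk_left) fun x y => ?_
    have hlin : e.symm (a * s + b * t, a • x + b • y) =
        a • e.symm (s, x) + b • e.symm (t, y) := by
      ext i
      refine Fin.cases ?_ (fun j => ?_) i <;>
        simp [e, MeasurableEquiv.piFinSuccAbove]
    simp only [hlin]
    exact H _ _

/-- The Prékopa–Leindler inequality on Euclidean space. -/
lemma prekopaLeindler_euclideanSpace (ha : 0 < a) (hb : 0 < b) (hab : a + b = 1) {n : ℕ}
    {f g h : EuclideanSpace ℝ (Fin n) → ENNReal}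
    (hf : Measurable f) (hg : Measurable g) (hh : Measurable h)
    (H : ∀ x y, f x ^ a * g y ^ b ≤ h (a • x + b • y)) :
    (∫⁻ x, f x) ^ a * (∫⁻ x, g x) ^ b ≤ ∫⁻ x, h x := by
  have hp := PiLp.volume_preserving_toLp (Fin n)
  rw [← hp.lintegral_comp hf, ← hp.lintegral_comp hg, ← hp.lintegral_comp hh]
  exact prekopaLeindler_pi ha hb hab n (hf.comp hp.measurable) (hg.comp hp.measurable)
    (hh.comp hp.measurable) fun x y => by simpa using H (WithLp.toLp 2 x) (WithLp.toLp 2 y)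

end PrekopaLeindler

section Pinsker

/-- Padé-type lower bound for the logarithm, of third order at `1`. -/
lemma Real.div_le_log_of_pos {x : ℝ} (hx : 0 < x) :
    (5 * x ^ 2 - 4 * x - 1) / (2 * x ^ 2 + 4 * x) ≤ log x := by
  let g : ℝ → ℝ := fun x => log x - (5 * x ^ 2 - 4 * x - 1) / (2 * x ^ 2 + 4 * x)
  have hg : ∀ y > 0, HasDerivAt g (4 * (y - 1) ^ 3 / (2 * y ^ 2 + 4 * y) ^ 2) y := by
    intro y hy
    have hden : 2 * y ^ 2 + 4 * y ≠ 0 := by positivity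
    have h1 : HasDerivAt (fun x : ℝ => 5 * x ^ 2 - 4 * x - 1) (10 * y - 4) y := by
      refine (((((hasDerivAt_id y).pow 2).const_mul 5).sub
        ((hasDerivAt_id y).const_mul 4)).sub_const 1).congr_deriv ?_
      simp; ring
    have h2 : HasDerivAt (fun x : ℝ => 2 * x ^ 2 + 4 * x) (4 * y + 4) y := by
      refine ((((hasDerivAt_id y).pow 2).const_mul 2).add
        ((hasDerivAt_id y).const_mul 4)).congr_deriv ?_
      simp; ring
    refine ((hasDerivAt_log hy.ne').sub (h1.div h2 hden)).congr_deriv ?_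
    field_simp
    ring
  have hg1 : g 1 = 0 := by simp [g]; norm_num
  have hcont : ∀ S : Set ℝ, (∀ y ∈ S, 0 < y) → ContinuousOn g S := fun S hS y hy =>
    (hg y (hS y hy)).continuousAt.continuousWithinAt
  suffices 0 ≤ g x by simpa [g] using this
  rw [← hg1]
  rcases le_total x 1 with h | h
  · have hpos : ∀ y ∈ Set.Icc x 1, 0 < y := fun y hy => hx.trans_le hy.1
    refine antitoneOn_of_deriv_nonpos (convex_Icc x 1) (hcont _ hpos) ?_ ?_
      (Set.left_mem_Icc.2 h) (Set.right_mem_Icc.2 h) h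
    · exact fun y hy => (hg y (hpos y (interior_subset hy))).differentiableAt.differentiableWithinAt
    · intro y hy
      have hy' := interior_subset hy
      have hy0 := hpos y hy'
      rw [(hg y hy0).deriv]
      have : (y - 1) ^ 3 ≤ 0 := by
        have := pow_nonneg (sub_nonneg.2 hy'.2) 3
        nlinarith
      exact div_nonpos_of_nonpos_of_nonneg (by linarith) (by positivity)
  · have hpos : ∀ y ∈ Set.Icc 1 x, 0 < y := fun y hy => zero_lt_one.trans_le hy.1
    refine monotoneOn_of_deriv_nonneg (convex_Icc 1 x) (hcont _ hpos) ?_ ?_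
      (Set.left_mem_Icc.2 h) (Set.right_mem_Icc.2 h) h
    · exact fun y hy => (hg y (hpos y (interior_subset hy))).differentiableAt.differentiableWithinAt
    · intro y hy
      have hy' := interior_subset hy
      have hy0 := hpos y hy'
      rw [(hg y hy0).deriv]
      have : 0 ≤ (y - 1) ^ 3 := pow_nonneg (sub_nonneg.2 hy'.1) 3
      positivity

lemma abs_sub_le_mul_add_log_div {p q c : ℝ} (hp : 0 < p) (hq : 0 < q) (hc : 0 < c) :
    |p - q| ≤ c * (2 * p + 4 * q) / 6 + (log (p / q) * p - p + q) / (2 * c) := by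
  set k := log (p / q) * p - p + q with hk
  have h1 : 3 * (p - q) ^ 2 ≤ (2 * p + 4 * q) * k := by
    have := Real.div_le_log_of_pos (div_pos hp hq)
    have e : (5 * (p / q) ^ 2 - 4 * (p / q) - 1) / (2 * (p / q) ^ 2 + 4 * (p / q)) =
        (5 * p ^ 2 - 4 * p * q - q ^ 2) / (p * (2 * p + 4 * q)) := by
      field_simp
    rw [e, div_le_iff₀ (by positivity)] at this
    rw [hk]
    linarith
  have h2 : |p - q| = √((p - q) ^ 2) := (sqrt_sq_eq_abs _).symm
  rw [h2]
  have e : c * (2 * p + 4 * q) / 6 + k / (2 * c) =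
      (c ^ 2 * (2 * p + 4 * q) + 3 * k) / (6 * c) := by
    field_simp
    ring
  have hk0 : 0 ≤ k := by
    have : 0 ≤ (2 * p + 4 * q) * k := (by positivity : 0 ≤ 3 * (p - q) ^ 2).trans h1
    exact nonneg_of_mul_nonneg_right this (by positivity)
  rw [e]
  refine sqrt_le_iff.2 ⟨by positivity, ?_⟩
  rw [div_pow, le_div_iff₀ (by positivity)]
  have h3 : 3 * (p - q) ^ 2 * (12 * c ^ 2) ≤ (2 * p + 4 * q) * k * (12 * c ^ 2) := by gcongr
  nlinarith [sq_nonneg (c ^ 2 * (2 * p + 4 * q) - 3 * k)]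

/-- Linearised form of Pinsker's inequality for densities. -/
lemma integral_abs_sub_le_add_div {α : Type*} [MeasurableSpace α] {μ : Measure α} {p q : α → ℝ}
    {c : ℝ} (hc : 0 < c) (hp : ∀ x, 0 < p x) (hq : ∀ x, 0 < q x)
    (hpi : Integrable p μ) (hqi : Integrable q μ) (hp1 : ∫ x, p x ∂μ = 1) (hq1 : ∫ x, q x ∂μ = 1)
    (hi : Integrable (fun x => log (p x / q x) * p x) μ) :
    ∫ x, |p x - q x| ∂μ ≤ c + (∫ x, log (p x / q x) * p x ∂μ) / (2 * c) := by
  have i1 : Integrable (fun x => c * (2 * p x + 4 * q x) / 6) μ :=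
    (((hpi.const_mul 2).add (hqi.const_mul 4)).const_mul c).div_const 6
  have i2 : Integrable (fun x => (log (p x / q x) * p x - p x + q x) / (2 * c)) μ :=
    ((hi.sub hpi).add hqi).div_const _
  calc ∫ x, |p x - q x| ∂μ
      ≤ ∫ x, (c * (2 * p x + 4 * q x) / 6 + (log (p x / q x) * p x - p x + q x) / (2 * c)) ∂μ :=
        integral_mono (hpi.sub hqi).abs (i1.add i2) fun x =>
          abs_sub_le_mul_add_log_div (hp x) (hq x) hc
    _ = _ := by
        rw [integral_add i1 i2, integral_div, integral_const_mul,
          integral_add (hpi.const_mul 2) (hqi.const_mul 4), integral_const_mul,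
          integral_const_mul, integral_div,
          integral_add (f := fun x => log (p x / q x) * p x - p x) (hi.sub hpi) hqi,
          integral_sub hi hpi, hp1, hq1]
        ring

end Pinsker

section Gibbs

variable {d : ℕ} {h : EuclideanSpace ℝ (Fin d) → ℝ}

/-- The unnormalised Gibbs weight of a potential `h` plus a quadratic of curvature `s`. -/
def quadWeight (h : EuclideanSpace ℝ (Fin d) → ℝ) (s : ℝ) (z : EuclideanSpace ℝ (Fin d)) : ℝ :=
  exp (-h z - s / 2 * ‖z‖ ^ 2)

/-- The partition function of `quadWeight`. -/
def quadPartition (h : EuclideanSpace ℝ (Fin d) → ℝ) (s : ℝ) : ℝ :=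
  ∫ z, quadWeight h s z

/-- The unnormalised second moment of `quadWeight`. -/
def quadMoment (h : EuclideanSpace ℝ (Fin d) → ℝ) (s : ℝ) : ℝ :=
  ∫ z, ‖z‖ ^ 2 * quadWeight h s z

lemma quadWeight_pos (h : EuclideanSpace ℝ (Fin d) → ℝ) (s : ℝ) (z : EuclideanSpace ℝ (Fin d)) :
    0 < quadWeight h s z := exp_pos _

lemma continuous_quadWeight (hc : Continuous h) (s : ℝ) : Continuous (quadWeight h s) := by
  unfold quadWeight
  fun_prop

lemma Integrable.quadWeight_mono (hc : Continuous h) {s t : ℝ} (hst : s ≤ t)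
    (hi : Integrable (quadWeight h s)) : Integrable (quadWeight h t) := by
  refine hi.mono' (continuous_quadWeight hc t).aestronglyMeasurable (.of_forall fun z => ?_)
  rw [norm_of_nonneg (quadWeight_pos h t z).le]
  unfold quadWeight
  gcongr

lemma quadPartition_pos {s : ℝ} (hi : Integrable (quadWeight h s)) :
    0 < quadPartition h s :=
  integral_exp_pos hi

/-- Convexity of the perspective function of the squared norm. -/
lemma norm_sq_div_le_add {E : Type*} [SeminormedAddCommGroup E] [NormedSpace ℝ E]
    {a b r s : ℝ} (ha : 0 < a) (hb : 0 < b) (hr : 0 < r) (hs : 0 < s) (x y : E) :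
    ‖a • x + b • y‖ ^ 2 / (a * r + b * s) ≤ a * (‖x‖ ^ 2 / r) + b * (‖y‖ ^ 2 / s) := by
  have h1 : ‖a • x + b • y‖ ≤ a * ‖x‖ + b * ‖y‖ := by
    refine (norm_add_le _ _).trans_eq ?_
    rw [norm_smul_of_nonneg ha.le, norm_smul_of_nonneg hb.le]
  have h2 : ‖a • x + b • y‖ ^ 2 ≤ (a * ‖x‖ + b * ‖y‖) ^ 2 := by gcongr
  rw [div_le_iff₀ (by positivity)]
  refine h2.trans ?_
  have e : (a * (‖x‖ ^ 2 / r) + b * (‖y‖ ^ 2 / s)) * (a * r + b * s) - (a * ‖x‖ + b * ‖y‖) ^ 2 =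
      a * b * (s * ‖x‖ - r * ‖y‖) ^ 2 / (r * s) := by
    field_simp
    ring
  have : 0 ≤ a * b * (s * ‖x‖ - r * ‖y‖) ^ 2 / (r * s) := by positivity
  linarith

/-- The partition function is log-concave in the inverse curvature. -/
lemma quadPartition_rpow_mul_rpow_le (hc : Continuous h) (hconv : ConvexOn ℝ Set.univ h)
    {a b r s : ℝ} (ha : 0 < a) (hb : 0 < b) (hab : a + b = 1) (hr : 0 < r) (hs : 0 < s)
    (hir : Integrable (quadWeight h r⁻¹)) (his : Integrable (quadWeight h s⁻¹))
    (hi : Integrable (quadWeight h (a * r + b * s)⁻¹)) :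
    quadPartition h r⁻¹ ^ a * quadPartition h s⁻¹ ^ b ≤ quadPartition h (a * r + b * s)⁻¹ := by
  have meas : ∀ t, Measurable fun z => ENNReal.ofReal (quadWeight h t z) := fun t =>
    (continuous_quadWeight hc t).measurable.ennreal_ofReal
  have key := prekopaLeindler_euclideanSpace ha hb hab (meas r⁻¹) (meas s⁻¹)
    (meas (a * r + b * s)⁻¹) (by
      intro x y
      rw [ENNReal.ofReal_rpow_of_nonneg (quadWeight_pos _ _ _).le ha.le,
        ENNReal.ofReal_rpow_of_nonneg (quadWeight_pos _ _ _).le hb.le,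
        ← ENNReal.ofReal_mul (rpow_nonneg (quadWeight_pos _ _ _).le _)]
      refine ENNReal.ofReal_le_ofReal ?_
      unfold quadWeight
      rw [← exp_mul, ← exp_mul, ← exp_add]
      refine exp_le_exp.2 ?_
      have h1 := hconv.2 (Set.mem_univ x) (Set.mem_univ y) ha.le hb.le hab
      have h2 := norm_sq_div_le_add ha hb hr hs x y
      simp only [smul_eq_mul, div_eq_mul_inv] at h1 h2
      linarith)
  have conv : ∀ {t}, Integrable (quadWeight h t) →
      ∫⁻ z, ENNReal.ofReal (quadWeight h t z) = ENNReal.ofReal (quadPartition h t) := fun hi =>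
    (ofReal_integral_eq_lintegral_ofReal hi (.of_forall fun z => (quadWeight_pos _ _ z).le)).symm
  rw [conv hir, conv his, conv hi,
    ENNReal.ofReal_rpow_of_nonneg (quadPartition_pos hir).le ha.le,
    ENNReal.ofReal_rpow_of_nonneg (quadPartition_pos his).le hb.le,
    ← ENNReal.ofReal_mul (rpow_nonneg (quadPartition_pos hir).le _)] at key
  exact (ENNReal.ofReal_le_ofReal_iff (quadPartition_pos hi).le).1 key

/-- Contracting towards a minimiser increases the weight at a quantified rate. -/
lemma quadWeight_mul_le_quadWeight_smul (hconv : ConvexOn ℝ Set.univ h) (h0 : ∀ z, h 0 ≤ h z)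
    {s τ : ℝ} (hτ : 0 < τ) (hτ1 : τ < 1) (z : EuclideanSpace ℝ (Fin d)) :
    quadWeight h s z + (1 - τ ^ 2) * (s / 2) * (‖z‖ ^ 2 * quadWeight h s z) ≤
      quadWeight h s (τ • z) := by
  have h1 : h (τ • z) ≤ h z := by
    have := hconv.2 (Set.mem_univ z) (Set.mem_univ 0) hτ.le (sub_nonneg.2 hτ1.le) (by ring)
    simp only [smul_zero, add_zero, smul_eq_mul] at this
    nlinarith [h0 z]
  have h2 : quadWeight h s z * exp ((1 - τ ^ 2) * (s / 2) * ‖z‖ ^ 2) ≤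
      quadWeight h s (τ • z) := by
    unfold quadWeight
    rw [← exp_add, norm_smul_of_nonneg hτ.le]
    refine exp_le_exp.2 ?_
    linarith
  refine le_trans ?_ h2
  have h3 := add_one_le_exp ((1 - τ ^ 2) * (s / 2) * ‖z‖ ^ 2)
  have h4 := mul_le_mul_of_nonneg_left h3 (quadWeight_pos h s z).le
  linarith

lemma integrable_norm_sq_mul_quadWeight (hc : Continuous h) (hconv : ConvexOn ℝ Set.univ h)
    (h0 : ∀ z, h 0 ≤ h z) {s : ℝ} (hs : 0 < s) (hi : Integrable (quadWeight h s)) :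
    Integrable fun z => ‖z‖ ^ 2 * quadWeight h s z := by
  have hi' : Integrable fun z => quadWeight h s ((1 / 2 : ℝ) • z) :=
    hi.comp_smul (by norm_num)
  refine (hi'.const_mul (8 / (3 * s))).mono' ?_ (.of_forall fun z => ?_)
  · exact ((continuous_norm.pow 2).mul (continuous_quadWeight hc s)).aestronglyMeasurable
  · have h1 := quadWeight_mul_le_quadWeight_smul hconv h0 (s := s) (τ := 1 / 2)
      (by norm_num) (by norm_num) z
    have h2 := quadWeight_pos h s z
    rw [norm_of_nonneg (by positivity), div_mul_eq_mul_div, le_div_iff₀ (by positivity)]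
    linarith

/-- The second moment of a log-concave measure with a potential of curvature at least `s`. -/
lemma mul_quadMoment_le (hc : Continuous h) (hconv : ConvexOn ℝ Set.univ h)
    (h0 : ∀ z, h 0 ≤ h z) {s : ℝ} (hs : 0 < s) (hi : Integrable (quadWeight h s)) :
    s * quadMoment h s ≤ d * quadPartition h s := by
  have hm := integrable_norm_sq_mul_quadWeight hc hconv h0 hs hi
  have hZ := quadPartition_pos hi
  have key : ∀ τ : ℝ, 0 < τ → τ < 1 →
      τ ^ d * ((1 + τ) / 2) * (s * quadMoment h s) ≤ d * quadPartition h s := by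
    intro τ hτ hτ1
    have h1 : ∫ z, (quadWeight h s z + (1 - τ ^ 2) * (s / 2) * (‖z‖ ^ 2 * quadWeight h s z)) ≤
        ∫ z, quadWeight h s (τ • z) :=
      integral_mono (hi.add (hm.const_mul _)) (hi.comp_smul hτ.ne') fun z =>
        quadWeight_mul_le_quadWeight_smul hconv h0 hτ hτ1 z
    rw [integral_add hi (hm.const_mul _), integral_const_mul, Measure.integral_comp_smul,
      finrank_euclideanSpace_fin, abs_of_pos (by positivity), smul_eq_mul] at h1
    change quadPartition h s + (1 - τ ^ 2) * (s / 2) * quadMoment h s ≤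
      (τ ^ d)⁻¹ * quadPartition h s at h1
    have h2 := mul_le_mul_of_nonneg_left h1 (pow_pos hτ d).le
    rw [mul_inv_cancel_left₀ (pow_pos hτ d).ne'] at h2
    have h3 : 1 + d * (τ - 1) ≤ τ ^ d := by
      have := one_add_mul_le_pow (a := τ - 1) (by linarith) d
      simpa using this
    have h4 : (1 - τ ^ d) * quadPartition h s ≤ d * (1 - τ) * quadPartition h s := by
      gcongr
      linarith
    refine le_of_mul_le_mul_left ?_ (sub_pos.2 hτ1)
    linarith
  have lim : Filter.Tendsto (fun τ : ℝ => τ ^ d * ((1 + τ) / 2) * (s * quadMoment h s))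
      (nhdsWithin 1 (Set.Iio 1)) (nhds (s * quadMoment h s)) := by
    have : Continuous fun τ : ℝ => τ ^ d * ((1 + τ) / 2) * (s * quadMoment h s) := by fun_prop
    have := this.tendsto 1
    norm_num at this
    exact this.mono_left nhdsWithin_le_nhds
  refine le_of_tendsto lim ?_
  filter_upwards [Ioo_mem_nhdsLT (zero_lt_one' ℝ)] with τ hτ using key τ hτ.1 hτ.2

lemma log_quadPartition_sub_le_of_le (hc : Continuous h)
    {s t : ℝ} (hst : s ≤ t) (hi : Integrable (quadWeight h s))
    (hm : Integrable fun z => ‖z‖ ^ 2 * quadWeight h s z) :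
    log (quadPartition h s) - log (quadPartition h t) ≤
      (t - s) / 2 * (quadMoment h s / quadPartition h s) := by
  have hit := Integrable.quadWeight_mono hc hst hi
  have hZ := quadPartition_pos hi
  set c := (t - s) / 2 * (quadMoment h s / quadPartition h s) with hcdef
  have hcZ : c * quadPartition h s = (t - s) / 2 * quadMoment h s := by
    rw [hcdef]; field_simp
  have hpt : ∀ z, exp (-c) * ((1 + c) * quadWeight h s z -
      (t - s) / 2 * (‖z‖ ^ 2 * quadWeight h s z)) ≤ quadWeight h t z := by
    intro z
    have e : quadWeight h t z =
        exp (-c) * (quadWeight h s z * exp (c - (t - s) / 2 * ‖z‖ ^ 2)) := by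
      unfold quadWeight
      rw [← exp_add, ← exp_add]
      ring_nf
    rw [e]
    have h3 := add_one_le_exp (c - (t - s) / 2 * ‖z‖ ^ 2)
    have h4 := mul_le_mul_of_nonneg_left h3 (quadWeight_pos h s z).le
    gcongr
    linarith
  have h1 : ∫ z, exp (-c) * ((1 + c) * quadWeight h s z -
      (t - s) / 2 * (‖z‖ ^ 2 * quadWeight h s z)) ≤ ∫ z, quadWeight h t z :=
    integral_mono (((hi.const_mul (1 + c)).sub (hm.const_mul ((t - s) / 2))).const_mul
      (exp (-c))) hit hpt
  rw [integral_const_mul, integral_sub (hi.const_mul _) (hm.const_mul _), integral_const_mul,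
    integral_const_mul] at h1
  change exp (-c) * ((1 + c) * quadPartition h s - (t - s) / 2 * quadMoment h s) ≤
    quadPartition h t at h1
  rw [← hcZ, show (1 + c) * quadPartition h s - c * quadPartition h s = quadPartition h s by ring]
    at h1
  have h2 := log_le_log (by positivity) h1
  rw [log_mul (exp_pos _).ne' hZ.ne', log_exp] at h2
  linarith

lemma log_quadPartition_sub_le_of_lt (hc : Continuous h) (hconv : ConvexOn ℝ Set.univ h)
    {r s : ℝ} (hr : 0 < r) (hrs : r < s) (hir : Integrable (quadWeight h r))
    (hm : Integrable fun z => ‖z‖ ^ 2 * quadWeight h s z) :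
    log (quadPartition h r) - log (quadPartition h s) ≤
      (s - r) * s / (2 * r) * (quadMoment h s / quadPartition h s) := by
  have hs := hr.trans hrs
  have his := Integrable.quadWeight_mono hc hrs.le hir
  set A := quadMoment h s / quadPartition h s
  have key : ∀ t, s < t → log (quadPartition h r) - log (quadPartition h s) ≤
      (s - r) * t / (2 * r) * A := by
    intro t hst
    have ht := hs.trans hst
    have hit := Integrable.quadWeight_mono hc hst.le his
    have hrt : 0 < t - r := by linarith
    have hst' : 0 < t - s := by linarith
    have hsr' : 0 < s - r := by linarith
    have ha : 0 < t * (s - r) / (s * (t - r)) := by positivity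
    have hb : 0 < r * (t - s) / (s * (t - r)) := by positivity
    have hab : t * (s - r) / (s * (t - r)) + r * (t - s) / (s * (t - r)) = 1 := by
      field_simp
      ring
    have hcomb : t * (s - r) / (s * (t - r)) * t⁻¹ + r * (t - s) / (s * (t - r)) * r⁻¹ = s⁻¹ := by
      field_simp
      ring
    have h1 := quadPartition_rpow_mul_rpow_le hc hconv ha hb hab (inv_pos.2 ht) (inv_pos.2 hr)
      (by rwa [inv_inv]) (by rwa [inv_inv]) (by rwa [hcomb, inv_inv])
    rw [hcomb, inv_inv, inv_inv, inv_inv] at h1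
    have hZt := quadPartition_pos hit
    have hZr := quadPartition_pos hir
    have h2 := log_le_log (by positivity) h1
    rw [log_mul (by positivity) (by positivity), log_rpow hZt, log_rpow hZr] at h2
    have h3 := log_quadPartition_sub_le_of_le hc hst.le his hm
    have h4 : t * (s - r) * (log (quadPartition h s) - log (quadPartition h t)) ≤
        t * (s - r) * ((t - s) / 2 * A) := by gcongr
    have h5 : t * (s - r) * log (quadPartition h t) + r * (t - s) * log (quadPartition h r) ≤
        s * (t - r) * log (quadPartition h s) := by
      have := mul_le_mul_of_nonneg_left h2 (by positivity : 0 ≤ s * (t - r))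
      field_simp at this
      linarith
    refine le_of_mul_le_mul_left ?_ (by positivity : 0 < r * (t - s))
    have e : r * (t - s) * ((s - r) * t / (2 * r) * A) = t * (s - r) * ((t - s) / 2 * A) := by
      field_simp
    rw [e]
    linarith
  have lim : Filter.Tendsto (fun t : ℝ => (s - r) * t / (2 * r) * A)
      (nhdsWithin s (Set.Ioi s)) (nhds ((s - r) * s / (2 * r) * A)) := by
    have : Continuous fun t : ℝ => (s - r) * t / (2 * r) * A := by fun_prop
    exact (this.tendsto s).mono_left nhdsWithin_le_nhds
  refine ge_of_tendsto lim ?_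
  filter_upwards [self_mem_nhdsWithin] with t ht using key t ht

lemma log_quadWeight_div_mul_eq {r s : ℝ} (hir : Integrable (quadWeight h r))
    (his : Integrable (quadWeight h s)) (z : EuclideanSpace ℝ (Fin d)) :
    log (quadWeight h s z / quadPartition h s / (quadWeight h r z / quadPartition h r)) *
        (quadWeight h s z / quadPartition h s) =
      (log (quadPartition h r) - log (quadPartition h s)) / quadPartition h s *
          quadWeight h s z -
        (s - r) / 2 / quadPartition h s * (‖z‖ ^ 2 * quadWeight h s z) := by
  have hZr := quadPartition_pos hir
  have hZs := quadPartition_pos his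
  have hWr := quadWeight_pos h r z
  have hWs := quadWeight_pos h s z
  have e : log (quadWeight h s z) - log (quadWeight h r z) = -((s - r) / 2 * ‖z‖ ^ 2) := by
    unfold quadWeight
    rw [log_exp, log_exp]
    ring
  rw [log_div (by positivity) (by positivity), log_div hWs.ne' hZs.ne', log_div hWr.ne' hZr.ne']
  have e2 : log (quadWeight h s z) - log (quadPartition h s) -
      (log (quadWeight h r z) - log (quadPartition h r)) =
      log (quadPartition h r) - log (quadPartition h s) - (s - r) / 2 * ‖z‖ ^ 2 := by linarith
  rw [e2]
  field_simp

lemma integrable_log_quadWeight_div_mul {r s : ℝ} (hir : Integrable (quadWeight h r))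
    (his : Integrable (quadWeight h s)) (hm : Integrable fun z => ‖z‖ ^ 2 * quadWeight h s z) :
    Integrable fun z =>
      log (quadWeight h s z / quadPartition h s / (quadWeight h r z / quadPartition h r)) *
        (quadWeight h s z / quadPartition h s) := by
  simp only [log_quadWeight_div_mul_eq hir his]
  exact (his.const_mul _).sub (hm.const_mul _)

lemma integral_log_quadWeight_div_mul_le (hc : Continuous h) (hconv : ConvexOn ℝ Set.univ h)
    (h0 : ∀ z, h 0 ≤ h z) {r s : ℝ} (hr : 0 < r) (hrs : r < s)
    (hir : Integrable (quadWeight h r)) :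
    ∫ z, log (quadWeight h s z / quadPartition h s / (quadWeight h r z / quadPartition h r)) *
        (quadWeight h s z / quadPartition h s) ≤ d * (s - r) ^ 2 / (2 * r * s) := by
  have hs := hr.trans hrs
  have his := Integrable.quadWeight_mono hc hrs.le hir
  have hm := integrable_norm_sq_mul_quadWeight hc hconv h0 hs his
  have hZ := quadPartition_pos his
  simp only [log_quadWeight_div_mul_eq hir his]
  rw [integral_sub (his.const_mul _) (hm.const_mul _), integral_const_mul, integral_const_mul]
  change (log (quadPartition h r) - log (quadPartition h s)) / quadPartition h s *
    quadPartition h s - (s - r) / 2 / quadPartition h s * quadMoment h s ≤ _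
  have h1 := log_quadPartition_sub_le_of_lt hc hconv hr hrs hir hm
  have h2 : quadMoment h s / quadPartition h s ≤ d / s := by
    rw [div_le_div_iff₀ hZ hs]
    linarith [mul_quadMoment_le hc hconv h0 hs his]
  set A := quadMoment h s / quadPartition h s with hA
  rw [div_mul_cancel₀ _ hZ.ne',
    show (s - r) / 2 / quadPartition h s * quadMoment h s = (s - r) / 2 * A by rw [hA]; ring]
  calc _ ≤ (s - r) * s / (2 * r) * A - (s - r) / 2 * A := by linarith
    _ = (s - r) ^ 2 / (2 * r) * A := by field_simp
    _ ≤ (s - r) ^ 2 / (2 * r) * (d / s) := by gcongr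
    _ = _ := by field_simp

end Gibbs

section CompositeDensities

variable {d : ℕ}

/-- Subtracting the centred quadratic from a strongly convex function leaves a convex function. -/
lemma StrongConvexOn.convexOn_comp_add_sub {E : Type*} [NormedAddCommGroup E]
    [InnerProductSpace ℝ E] {f : E → ℝ} {m : ℝ} (hf : StrongConvexOn Set.univ m f) (u : E) :
    ConvexOn ℝ Set.univ fun z => f (u + z) - m / 2 * ‖z‖ ^ 2 := by
  have hf' : StrongConvexOn Set.univ m fun z => f (u + z) := by
    refine ⟨convex_univ, fun x _ y _ a b ha hb hab => ?_⟩
    have := hf.2 (Set.mem_univ (u + x)) (Set.mem_univ (u + y)) ha hb hab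
    have e : a • (u + x) + b • (u + y) = u + (a • x + b • y) := by
      rw [smul_add, smul_add, add_add_add_comm, ← add_smul, hab, one_smul]
    rwa [e, add_sub_add_left_eq_sub] at this
  exact strongConvexOn_iff_convex.1 hf'

/-- A convex function with a vanishing derivative at a point is minimal there. -/
lemma ConvexOn.le_of_hasFDerivAt_zero {E : Type*} [NormedAddCommGroup E] [NormedSpace ℝ E]
    {h : E → ℝ} (hconv : ConvexOn ℝ Set.univ h) {x : E} (hx : HasFDerivAt h (0 : E →L[ℝ] ℝ) x)
    (z : E) : h x ≤ h z := by
  have hline : ConvexOn ℝ Set.univ (h ∘ AffineMap.lineMap (k := ℝ) x z) :=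
    hconv.comp_affineMap _
  have hd : HasDerivAt (h ∘ AffineMap.lineMap (k := ℝ) x z) 0 0 := by
    have h1 : HasDerivAt (AffineMap.lineMap (k := ℝ) x z) (z - x) 0 :=
      AffineMap.hasDerivAt_lineMap
    have h2 : HasFDerivAt h (0 : E →L[ℝ] ℝ) (AffineMap.lineMap (k := ℝ) x z 0) := by
      simpa using hx
    simpa using h2.comp_hasDerivAt (0 : ℝ) h1
  have := hline.le_slope_of_hasDerivAt (Set.mem_univ 0) (Set.mem_univ 1) one_pos hd
  simpa [slope_def_field] using this

/-- Convolving the two quadratic factors in `y` yields a quadratic in `x`. -/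
lemma exists_integral_exp_quadratic_eq {σ η : ℝ} (hσ : 0 < σ) (hη : 0 < η)
    (f : EuclideanSpace ℝ (Fin d) → ℝ) (u : EuclideanSpace ℝ (Fin d)) :
    ∃ C > 0, ∀ x, ∫ y, exp (-f x - ‖y - u‖ ^ 2 / (2 * σ ^ 2) - ‖x - y‖ ^ 2 / (2 * η)) =
      C * exp (-f x - (σ ^ 2 + η)⁻¹ / 2 * ‖x - u‖ ^ 2) := by
  set B := (2 * σ ^ 2)⁻¹ + (2 * η)⁻¹ with hB
  have hBpos : 0 < B := by positivity
  refine ⟨∫ y : EuclideanSpace ℝ (Fin d), exp (-B * ‖y‖ ^ 2), ?_, fun x => ?_⟩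
  · rw [GaussianFourier.integral_rexp_neg_mul_sq_norm hBpos]
    positivity
  · let k : ℝ := σ ^ 2 / (σ ^ 2 + η)
    have e : ∀ y, exp (-f x - ‖y - u‖ ^ 2 / (2 * σ ^ 2) - ‖x - y‖ ^ 2 / (2 * η)) =
        exp (-B * ‖y - (u + k • (x - u))‖ ^ 2) *
          exp (-f x - (σ ^ 2 + η)⁻¹ / 2 * ‖x - u‖ ^ 2) := by
      intro y
      rw [← exp_add]
      congr 1
      have e1 : x - y = (x - u) - (y - u) := by abel
      have e2 : y - (u + k • (x - u)) = (y - u) - k • (x - u) := by abel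
      rw [e1, e2]
      generalize x - u = v
      generalize y - u = w
      rw [norm_sub_sq_real, norm_sub_sq_real, inner_smul_right, norm_smul, mul_pow,
        norm_eq_abs, sq_abs, real_inner_comm]
      simp only [hB, k]
      field_simp
      ring
    simp only [e]
    rw [integral_mul_const,
      integral_sub_right_eq_self (fun y : EuclideanSpace ℝ (Fin d) => exp (-B * ‖y‖ ^ 2))]

lemma quadMargDens_eq {σ η : ℝ} (hσ : 0 < σ) (hη : 0 < η)
    (f : EuclideanSpace ℝ (Fin d) → ℝ) (u x : EuclideanSpace ℝ (Fin d)) :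
    quadMargDens d f u σ η x =
      exp (-f x - (σ ^ 2 + η)⁻¹ / 2 * ‖x - u‖ ^ 2) /
        ∫ x', exp (-f x' - (σ ^ 2 + η)⁻¹ / 2 * ‖x' - u‖ ^ 2) := by
  obtain ⟨C, hC, h⟩ := exists_integral_exp_quadratic_eq hσ hη f u
  simp only [quadMargDens, h]
  rw [integral_const_mul, mul_div_mul_left _ _ hC.ne']

lemma quadCompDens_eq (σ : ℝ)
    (f : EuclideanSpace ℝ (Fin d) → ℝ) (u x : EuclideanSpace ℝ (Fin d)) :
    quadCompDens d f u σ x =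
      exp (-f x - (σ ^ 2)⁻¹ / 2 * ‖x - u‖ ^ 2) /
        ∫ x', exp (-f x' - (σ ^ 2)⁻¹ / 2 * ‖x' - u‖ ^ 2) := by
  have e : ∀ r : ℝ, r / (2 * σ ^ 2) = (σ ^ 2)⁻¹ / 2 * r := fun r => by
    rw [div_eq_mul_inv, mul_inv]; ring
  simp only [quadCompDens, e]

lemma exp_div_integral_add_eq (f : EuclideanSpace ℝ (Fin d) → ℝ) (m t : ℝ)
    (u z : EuclideanSpace ℝ (Fin d)) :
    exp (-f (u + z) - t / 2 * ‖u + z - u‖ ^ 2) / (∫ x, exp (-f x - t / 2 * ‖x - u‖ ^ 2)) =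
      quadWeight (fun z => f (u + z) - m / 2 * ‖z‖ ^ 2) (m + t) z /
        quadPartition (fun z => f (u + z) - m / 2 * ‖z‖ ^ 2) (m + t) := by
  have e : ∀ z, exp (-f (u + z) - t / 2 * ‖u + z - u‖ ^ 2) =
      quadWeight (fun z => f (u + z) - m / 2 * ‖z‖ ^ 2) (m + t) z := by
    intro z
    rw [quadWeight, add_sub_cancel_left]
    ring_nf
  rw [← integral_add_left_eq_self _ u]
  simp only [e]
  rfl

end CompositeDensities

/-- non-asymptotic rate for a quadratic component:
`D_KL(ν ‖ π_η^X) ≤ dη²/(2(α_f σ⁴ + σ²)²)` and `TV(π_η^X, ν) ≤ η√d/(2(α_f σ⁴ + σ²))`. -/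
theorem kl_tv_bound_quadratic_component
    (hd : 1 ≤ d) (σ : ℝ) (hσ : 0 < σ) (u : EuclideanSpace ℝ (Fin d))
    (η : ℝ) (hη : 0 < η)
    (f : EuclideanSpace ℝ (Fin d) → ℝ) (αf : ℝ) (hαf : 0 < αf)
    (hfsc : StrongConvexOn Set.univ αf f)
    (hfC2 : ContDiff ℝ 2 f)
    (hmin : gradient f u = 0)
    (hfint : Integrable (fun x => Real.exp (-f x))) :
    klDivDens d (quadCompDens d f u σ) (quadMargDens d f u σ η) ≤
      (d : ℝ) * η ^ 2 / (2 * (αf * σ ^ 4 + σ ^ 2) ^ 2) ∧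
    tvDistDens d (quadMargDens d f u σ η) (quadCompDens d f u σ) ≤
      η * Real.sqrt d / (2 * (αf * σ ^ 4 + σ ^ 2)) := by
  set h : EuclideanSpace ℝ (Fin d) → ℝ := fun z => f (u + z) - αf / 2 * ‖z‖ ^ 2 with hh
  set r := αf + (σ ^ 2 + η)⁻¹ with hr
  set s := αf + (σ ^ 2)⁻¹ with hs
  have hr0 : 0 < r := by positivity
  have hrs : r < s := by
    rw [hr, hs]
    gcongr
    linarith
  have hs0 : 0 < s := hr0.trans hrs
  have hc : Continuous h := by
    have := hfC2.continuous
    fun_prop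
  have hconv : ConvexOn ℝ Set.univ h := hfsc.convexOn_comp_add_sub u
  have h0 : ∀ z, h 0 ≤ h z := by
    refine hconv.le_of_hasFDerivAt_zero ?_
    have h1 : HasFDerivAt f (0 : EuclideanSpace ℝ (Fin d) →L[ℝ] ℝ) u := by
      have := ((hfC2.differentiable (by norm_num)) u).hasGradientAt.hasFDerivAt
      rwa [hmin, map_zero] at this
    have h2 : HasFDerivAt (fun z => f (u + z)) (0 : EuclideanSpace ℝ (Fin d) →L[ℝ] ℝ) 0 := by
      rw [← add_zero u] at h1
      exact (hasFDerivAt_comp_add_left u).2 h1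
    have h3 := ((hasStrictFDerivAt_norm_sq (0 : EuclideanSpace ℝ (Fin d))).hasFDerivAt).const_mul
      (αf / 2)
    exact (h2.sub h3).congr_fderiv (by simp)
  have hi : Integrable (quadWeight h αf) := by
    have e : quadWeight h αf = fun z => exp (-f (u + z)) := by
      ext z
      simp only [quadWeight, hh]
      ring_nf
    rw [e]
    exact hfint.comp_add_left u
  have hir : Integrable (quadWeight h r) :=
    Integrable.quadWeight_mono hc (by rw [hr]; linarith [inv_pos.2 (by positivity : 0 < σ ^ 2 + η)])
      hi
  have his := Integrable.quadWeight_mono hc hrs.le hir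
  have hν : ∀ z, quadCompDens d f u σ (u + z) = quadWeight h s z / quadPartition h s := fun z => by
    rw [quadCompDens_eq, exp_div_integral_add_eq f αf]
  have hπ : ∀ z, quadMargDens d f u σ η (u + z) = quadWeight h r z / quadPartition h r :=
    fun z => by rw [quadMargDens_eq hσ hη, exp_div_integral_add_eq f αf]
  set T := αf * σ ^ 4 + σ ^ 2 with hT
  have hT0 : 0 < T := by positivity
  have hd0 : (0 : ℝ) < d := by exact_mod_cast hd
  have hsr : (s - r) / r ≤ η / T := by
    have e : (s - r) / r = η / (T + αf * σ ^ 2 * η) := by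
      have : r ≠ 0 := hr0.ne'
      rw [div_eq_div_iff this (by positivity), hs, hr, hT]
      field_simp
      ring
    rw [e]
    gcongr
    have : 0 ≤ αf * σ ^ 2 * η := by positivity
    linarith
  have hrate : d * (s - r) ^ 2 / (2 * r * s) ≤ d * η ^ 2 / (2 * T ^ 2) := by
    have hsr0 : 0 < s - r := sub_pos.2 hrs
    calc d * (s - r) ^ 2 / (2 * r * s) ≤ d * (s - r) ^ 2 / (2 * r * r) := by gcongr
      _ = d / 2 * ((s - r) / r) ^ 2 := by field_simp
      _ ≤ d / 2 * (η / T) ^ 2 := by gcongr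
      _ = d * η ^ 2 / (2 * T ^ 2) := by field_simp
  have hKL := (integral_log_quadWeight_div_mul_le hc hconv h0 hr0 hrs hir).trans hrate
  refine ⟨?_, ?_⟩
  · rw [klDivDens, ← integral_add_left_eq_self _ u]
    simpa only [hν, hπ] using hKL
  · rw [tvDistDens, ← integral_add_left_eq_self _ u]
    simp only [hν, hπ]
    set c := η * √d / (2 * T) with hcdef
    have hc0 : 0 < c := by positivity
    have hcc : d * η ^ 2 / (2 * T ^ 2) = 2 * c * c := by
      have := Real.sq_sqrt hd0.le
      rw [hcdef]
      field_simp
      linarith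
    have integral_div_eq_one : ∀ {t}, Integrable (quadWeight h t) →
        ∫ z, quadWeight h t z / quadPartition h t = 1 := fun hi => by
      rw [integral_div]
      exact div_self (quadPartition_pos hi).ne'
    have hP := integral_abs_sub_le_add_div hc0
      (fun z => div_pos (quadWeight_pos h s z) (quadPartition_pos his))
      (fun z => div_pos (quadWeight_pos h r z) (quadPartition_pos hir))
      (his.div_const _) (hir.div_const _) (integral_div_eq_one his) (integral_div_eq_one hir)
      (integrable_log_quadWeight_div_mul hir his
        (integrable_norm_sq_mul_quadWeight hc hconv h0 hs0 his))
    have hK : (∫ z, log (quadWeight h s z / quadPartition h s /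
        (quadWeight h r z / quadPartition h r)) * (quadWeight h s z / quadPartition h s)) /
          (2 * c) ≤ c := by
      rw [div_le_iff₀ (by positivity)]
      linarith
    simp only [abs_sub_comm (quadWeight h r _ / _)]
    linarith

end
end
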